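/- There exist a positive integer k and upper triangular k×k matrices M1, M2 with nonnegative integer entries such that, writing M for the multiplicative submonoid of the k×k matrices generated by M1 and M2, O for the zero matrix, and φ for the monoid homomorphism from the free monoid {1,2}* to the k×k matrices sending 1 to M1 and 2 to M2, the set of pairs of words (u,v) over {1,2} for which there exist matrices N1, N2 ∈ M with φ(u) N1 = φ(v) N2 ≠ O is not a decidable (computable) predicate on pairs of words. -/

import Mathlib

/-- A square matrix over ℕ is upper triangular if every entry below the diagonal is zero. -/
def MatrixUpperTriangular {k : ℕ} (M : Matrix (Fin k) (Fin k) ℕ) : Prop :=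
  ∀ i j : Fin k, j < i → M i j = 0

namespace S14
open Language Computability

/-! ### Closure properties of regular languages -/

def langUnion {α : Type} (p : Set (Language α)) : Language α := {y | ∃ Q ∈ p, y ∈ Q}

theorem mem_langUnion {α : Type} (p : Set (Language α)) (y : List α) :
    y ∈ langUnion p ↔ ∃ Q ∈ p, y ∈ Q := Iff.rfl

def sing {α : Type} (w : List α) : Language α := {y | y = w}

theorem mem_sing {α : Type} (w y : List α) : y ∈ sing w ↔ y = w := Iff.rfl

theorem reg_mul {α : Type} {L M : Language α} (hL : L.IsRegular) (hM : M.IsRegular) :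
    (L * M).IsRegular := by
  apply Language.IsRegular.of_finite_range_leftQuotient
  have h1 := hL.finite_range_leftQuotient
  have h2 := hM.finite_range_leftQuotient.finite_subsets
  refine ((h1.prod h2).image (fun p : Language α × Set (Language α) =>
    p.1 * M + langUnion p.2)).subset ?_
  rintro _ ⟨x, rfl⟩
  refine ⟨(L.leftQuotient x, {Q | ∃ a b, x = a ++ b ∧ a ∈ L ∧ Q = M.leftQuotient b}), ⟨⟨x, rfl⟩, ?_⟩, ?_⟩
  · rintro _ ⟨a, b, _, _, rfl⟩
    exact ⟨b, rfl⟩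
  · ext y
    simp only [Language.mem_add, Language.mem_leftQuotient, Language.mem_mul, mem_langUnion]
    constructor
    · rintro (⟨a, ha, b, hb, rfl⟩ | ⟨_, ⟨a, b, rfl, ha, rfl⟩, hy⟩)
      · exact ⟨x ++ a, ha, b, hb, by simp⟩
      · exact ⟨a, ha, b ++ y, hy, by simp⟩
    · rintro ⟨a, ha, b, hb, hab⟩
      rcases List.append_eq_append_iff.1 hab with ⟨c, rfl, rfl⟩ | ⟨c, rfl, rfl⟩
      · right
        exact ⟨_, ⟨a, c, rfl, ha, rfl⟩, hb⟩
      · left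
        exact ⟨c, ha, b, hb, rfl⟩

theorem reg_kstar {α : Type} {L : Language α} (hL : L.IsRegular) :
    (L∗).IsRegular := by
  apply Language.IsRegular.of_finite_range_leftQuotient
  have h2 := hL.finite_range_leftQuotient.finite_subsets
  refine ((h2.image (fun p : Set (Language α) =>
    langUnion p * L∗)).insert (L∗)).subset ?_
  rintro _ ⟨x, rfl⟩
  by_cases hx : x = []
  · subst hx; left; rfl
  right
  refine ⟨{Q | ∃ a b, x = a ++ b ∧ a ∈ L∗ ∧ Q = L.leftQuotient b}, ?_, ?_⟩
  · rintro _ ⟨a, b, _, _, rfl⟩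
    exact ⟨b, rfl⟩
  · ext y
    simp only [Language.mem_leftQuotient]
    constructor
    · intro hy
      obtain ⟨c, ⟨_, ⟨a, b, rfl, ha, rfl⟩, hc⟩, d, hd, rfl⟩ := Language.mem_mul.1 hy
      have : L∗ * L * L∗ ≤ L∗ := by
        calc L∗ * L * L∗ ≤ L∗ * L∗ := by gcongr; exact kstar_mul_le_kstar
          _ = L∗ := kstar_mul_kstar _
      apply this
      refine ⟨a ++ (b ++ c), ⟨a, ha, b ++ c, hc, rfl⟩, d, hd, by simp⟩
    · intro h
      obtain ⟨Ls, hLs, hmem⟩ := Language.mem_kstar.1 h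
      have key : ∀ (Ls : List (List α)) (x y a : List α), x ≠ [] → a ∈ L∗ → x ++ y = Ls.flatten →
          (∀ w ∈ Ls, w ∈ L) → ∃ a' b, a ++ x = a' ++ b ∧ a' ∈ L∗ ∧ y ∈ L.leftQuotient b * L∗ := by
        intro Ls
        induction Ls with
        | nil => intro x y a hx _ h; simp at h; exact absurd h.1 hx
        | cons w Ls ih =>
          intro x y a hx ha h hw
          rw [List.flatten_cons] at h
          rcases List.append_eq_append_iff.1 h with ⟨c, rfl, h2⟩ | ⟨c, rfl, h2⟩
          · refine ⟨a, x, rfl, ha, ?_⟩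
            rw [h2]
            exact ⟨c, hw _ (by simp), _, Language.mem_kstar.2 ⟨Ls, rfl, fun z hz => hw z (by simp [hz])⟩, rfl⟩
          · have haw : a ++ w ∈ L∗ := kstar_mul_le_kstar (a := L) ⟨a, ha, w, hw _ (by simp), rfl⟩
            by_cases hc : c = []
            · subst hc
              refine ⟨a, w, by simp, ha, ?_⟩
              simp at h2
              exact ⟨[], by change w ++ [] ∈ L; rw [List.append_nil]; exact hw w (by simp), y, Language.mem_kstar.2 ⟨Ls, h2.symm, fun z hz => hw z (by simp [hz])⟩, rfl⟩
            · obtain ⟨a', b, h3, h4, h5⟩ := ih c y (a ++ w) hc haw h2.symm (fun z hz => hw z (by simp [hz]))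
              exact ⟨a', b, by rw [← h3]; simp, h4, h5⟩
      obtain ⟨a', b, h3, h4, h5⟩ := key Ls x y [] hx (Language.nil_mem_kstar _) hLs hmem
      obtain ⟨c, hc, d, hd, rfl⟩ := Language.mem_mul.1 h5
      exact Language.mem_mul.2 ⟨c, ⟨_, ⟨a', b, h3, h4, rfl⟩, hc⟩, d, hd, rfl⟩

theorem reg_singleton {α : Type} (w : List α) : (sing w).IsRegular := by
  apply Language.IsRegular.of_finite_range_leftQuotient
  classical
  refine (((w.tails.toFinset : Set (List α)).toFinite.image sing).insert 0).subset ?_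
  rintro _ ⟨x, rfl⟩
  by_cases h : x <+: w
  · obtain ⟨t, rfl⟩ := h
    right
    refine ⟨t, by simp, ?_⟩
    ext y
    change y = t ↔ x ++ y = x ++ t
    simp
  · left
    ext y
    change x ++ y = w ↔ False
    simp only [iff_false]
    rintro rfl
    exact h ⟨y, rfl⟩

theorem reg_zero {α : Type} : (0 : Language α).IsRegular := by
  apply Language.IsRegular.of_finite_range_leftQuotient
  refine (Set.finite_singleton (0 : Language α)).subset ?_
  rintro _ ⟨x, rfl⟩
  rfl

end S14

namespace S14
open Turing Turing.ToPartrec Turing.PartrecToTM2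

/-! ### The source of undecidability -/

theorem cast_two_pow (n : ℕ) : ∃ p : PosNum, ((2 ^ n : ℕ) : Num) = Num.pos p ∧
    trPosNum p = List.replicate n Γ'.bit0 ++ [Γ'.bit1] := by
  induction n with
  | zero => exact ⟨PosNum.one, rfl, rfl⟩
  | succ n ih =>
    obtain ⟨p, h1, h2⟩ := ih
    refine ⟨PosNum.bit0 p, ?_, ?_⟩
    · rw [pow_succ, mul_two, Nat.cast_add, h1, Num.bit0_of_bit0]; rfl
    · rw [List.replicate_succ, List.cons_append, ← h2, trPosNum]

theorem trNat_two_pow (n : ℕ) : trNat (2 ^ n) = List.replicate n Γ'.bit0 ++ [Γ'.bit1] := by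
  obtain ⟨p, h1, h2⟩ := cast_two_pow n
  rw [trNat, h1, ← h2]; rfl

def initCfg (c : Code) (n : ℕ) : TM2.Cfg (fun _ : K' => Γ') Λ' (Option Γ') :=
  ⟨some (trNormal c Cont'.halt), none,
    K'.elim (List.replicate n Γ'.bit0 ++ [Γ'.bit1, Γ'.cons]) [] [] []⟩

def Halts (c : Code) (n : ℕ) : Prop :=
  ∃ v S, TM2.Reaches tr (initCfg c n) ⟨none, v, S⟩

theorem halts_iff (c : Code) (n : ℕ) : Halts c n ↔ (c.eval [2 ^ n]).Dom := by
  have h : init c [2 ^ n] = initCfg c n := by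
    simp [init, initCfg, trNat_two_pow]
    rfl
  have h2 : (c.eval [2 ^ n]).Dom ↔ (StateTransition.eval (TM2.step tr) (init c [2 ^ n])).Dom := by
    rw [tr_eval]; rfl
  rw [h2, Part.dom_iff_mem]
  constructor
  · rintro ⟨v, S, hr⟩
    exact ⟨_, StateTransition.mem_eval.2 ⟨by rw [h]; exact hr, rfl⟩⟩
  · rintro ⟨⟨l, v, S⟩, hy⟩
    obtain ⟨h3, h4⟩ := StateTransition.mem_eval.1 hy
    cases l with
    | none => exact ⟨v, S, by rw [h] at h3; exact h3⟩
    | some l => exact absurd h4 (Option.some_ne_none _)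

theorem primrec_two_pow : Primrec (fun n : ℕ => 2 ^ n) := by
  have : Primrec (fun n : ℕ => Nat.rec (motive := fun _ => ℕ) 1 (fun _ y => 2 * y) n) :=
    Primrec.nat_rec₁ 1 (Primrec.nat_mul.comp (Primrec.const 2) Primrec.snd)
  refine this.of_eq fun n => ?_
  induction n with
  | zero => rfl
  | succ n ih => simp only [ih]; ring

theorem exists_undecidable : ∃ c : Code, ¬ ComputablePred (Halts c) := by
  let f : ℕ →. ℕ := fun n => (Part.ofOption (Encodable.decode (α := Nat.Partrec.Code) n)).bind fun c =>
    Nat.Partrec.Code.eval c 0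
  have hf : Partrec f := by
    refine Partrec.bind (Computable.ofOption Computable.decode) ?_
    exact Nat.Partrec.Code.eval_part.comp Computable.snd (Computable.const 0)
  let f' : ℕ →. ℕ := fun m => (Nat.rfind fun k => (Part.some (decide (2 ^ k = m)) : Part Bool)).bind f
  have hf' : Partrec f' := by
    refine Partrec.bind (Partrec.rfind ?_) (hf.comp Computable.snd)
    have : Computable (fun p : ℕ × ℕ => decide (2 ^ p.2 = p.1)) :=
      (Primrec.eq.decide.comp (primrec_two_pow.comp Primrec.snd) Primrec.fst).to_comp
    exact this
  obtain ⟨c, hc⟩ := Code.exists_code (Nat.Partrec'.part_iff₁.2 hf')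
  refine ⟨c, fun hcp => ?_⟩
  have key : ∀ n, Halts c n ↔ (f n).Dom := by
    intro n
    have h1 := hc (List.Vector.cons (2 ^ n) List.Vector.nil)
    rw [halts_iff]
    have : c.eval [2 ^ n] = pure <$> f' (2 ^ n) := h1
    rw [this]
    have h2 : (Nat.rfind fun k => (Part.some (decide (2 ^ k = 2 ^ n)) : Part Bool)) = Part.some n := by
      rw [Part.eq_some_iff]
      refine Nat.mem_rfind.2 ?_
      simp
      intro m hm
      omega
    change (Part.map _ (f' (2 ^ n))).Dom ↔ _
    simp only [f', h2, Part.map_Dom]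
    rw [Part.bind_some n f]
  apply ComputablePred.halting_problem 0
  refine ComputablePred.computable_of_manyOneReducible ?_ hcp
  refine ⟨Encodable.encode, Computable.encode, fun a => ?_⟩
  rw [key]
  simp [f]

end S14

namespace S14
open Turing Turing.ToPartrec Turing.PartrecToTM2 Language
open scoped Computability

/-! ### Queue machines -/

/-- Symbols of the queue. -/
inductive Sym (Q : Type)
  | ctl (q : Q)
  | opn (k : K')
  | cls
  | sy (g : Γ')
  deriving DecidableEq

/-- Actions of the queue machine. -/
inductive Act (Q : Type)
  | rot (x : Sym Q)
  | push (k : K') (a : Γ')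
  | pop (k : K') (a : Γ')
  | test (k : K')
  | chg (q q' : Q)

instance finiteK : Finite K' :=
  Finite.of_surjective (fun n : Fin 4 => ![K'.main, K'.rev, K'.aux, K'.stack] n) (by
    intro k
    cases k
    exacts [⟨0, rfl⟩, ⟨1, rfl⟩, ⟨2, rfl⟩, ⟨3, rfl⟩])

instance finiteSym {Q : Type} [Finite Q] : Finite (Sym Q) :=
  Finite.of_surjective (fun x : Q ⊕ K' ⊕ Unit ⊕ Γ' => match x with
    | .inl q => Sym.ctl q
    | .inr (.inl k) => Sym.opn k
    | .inr (.inr (.inl _)) => Sym.cls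
    | .inr (.inr (.inr g)) => Sym.sy g) (by
    rintro (q | k | _ | g)
    exacts [⟨.inl q, rfl⟩, ⟨.inr (.inl k), rfl⟩, ⟨.inr (.inr (.inl ())), rfl⟩,
      ⟨.inr (.inr (.inr g)), rfl⟩])

instance finiteAct {Q : Type} [Finite Q] : Finite (Act Q) :=
  Finite.of_surjective (fun x : Sym Q ⊕ (K' × Γ') ⊕ (K' × Γ') ⊕ K' ⊕ (Q × Q) => match x with
    | .inl x => Act.rot x
    | .inr (.inl k) => Act.push k.1 k.2
    | .inr (.inr (.inl k)) => Act.pop k.1 k.2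
    | .inr (.inr (.inr (.inl k))) => Act.test k
    | .inr (.inr (.inr (.inr q))) => Act.chg q.1 q.2) (by
    rintro (x | ⟨k, a⟩ | ⟨k, a⟩ | k | ⟨q, q'⟩)
    exacts [⟨.inl x, rfl⟩, ⟨.inr (.inl (k, a)), rfl⟩, ⟨.inr (.inr (.inl (k, a))), rfl⟩,
      ⟨.inr (.inr (.inr (.inl k))), rfl⟩, ⟨.inr (.inr (.inr (.inr (q, q')))), rfl⟩])

section
variable {Q : Type}

def Act.inp : Act Q → List (Sym Q)
  | rot x => [x]
  | push k _ => [.opn k]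
  | pop k a => [.opn k, .sy a]
  | test k => [.opn k, .cls]
  | chg q _ => [.ctl q]

def Act.out : Act Q → List (Sym Q)
  | rot x => [x]
  | push k a => [.opn k, .sy a]
  | pop k _ => [.opn k]
  | test k => [.opn k, .cls]
  | chg _ q => [.ctl q]

def Run : List (Act Q) → List (Sym Q) → List (Sym Q) → Prop
  | [], q, q' => q = q'
  | a :: w, q, q' => ∃ r, q ++ a.out = a.inp ++ r ∧ Run w r q'

theorem run_append (w w' : List (Act Q)) (q q' : List (Sym Q)) :
    Run (w ++ w') q q' ↔ ∃ r, Run w q r ∧ Run w' r q' := by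
  induction w generalizing q with
  | nil => simp [Run]
  | cons a w ih =>
    simp only [List.cons_append, Run, ih]
    constructor
    · rintro ⟨r, h, r', h1, h2⟩; exact ⟨r', ⟨r, h, h1⟩, h2⟩
    · rintro ⟨r', ⟨r, h, h1⟩, h2⟩; exact ⟨r, h, r', h1, h2⟩

theorem run_eq (w : List (Act Q)) (q q' : List (Sym Q)) (h : Run w q q') :
    q ++ w.flatMap Act.out = w.flatMap Act.inp ++ q' := by
  induction w generalizing q with
  | nil => simpa [Run] using h
  | cons a w ih =>
    obtain ⟨r, h1, h2⟩ := h
    rw [List.flatMap_cons, List.flatMap_cons, ← List.append_assoc, h1, List.append_assoc, ih r h2,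
      List.append_assoc]

theorem run_of_eq [DecidableEq Q] (w : List (Act Q)) (q q' : List (Sym Q)) (hq : 1 ≤ q.count .cls)
    (h : q ++ w.flatMap Act.out = w.flatMap Act.inp ++ q') : Run w q q' := by
  induction w generalizing q with
  | nil => simpa [Run] using h
  | cons a w ih =>
    rw [List.flatMap_cons, List.flatMap_cons, ← List.append_assoc, List.append_assoc a.inp] at h
    have hc : a.inp.count Sym.cls = a.out.count Sym.cls := by
      cases a <;> simp [Act.inp, Act.out]
    rcases List.append_eq_append_iff.1 h with ⟨c, h1, h2⟩ | ⟨c, h1, h2⟩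
    · have := congrArg (List.count Sym.cls) h1
      simp at this
      omega
    · refine ⟨c, h1, ih c ?_ h2.symm⟩
      have := congrArg (List.count Sym.cls) h1
      simp at this
      omega

/-! ### States -/

def block (S : K' → List Γ') (k : K') : List (Sym Q) := .opn k :: ((S k).map .sy ++ [.cls])

abbrev St (Q : Type) := Q × (K' → List Γ')

def canon (s : St Q) : List (Sym Q) :=
  .ctl s.1 :: (block s.2 .main ++ (block s.2 .rev ++ (block s.2 .aux ++ block s.2 .stack)))

def rest (s : St Q) : K' → List (Sym Q)
  | .main => block s.2 .rev ++ (block s.2 .aux ++ (block s.2 .stack ++ [.ctl s.1]))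
  | .rev => block s.2 .aux ++ (block s.2 .stack ++ (.ctl s.1 :: block s.2 .main))
  | .aux => block s.2 .stack ++ (.ctl s.1 :: (block s.2 .main ++ block s.2 .rev))
  | .stack => .ctl s.1 :: (block s.2 .main ++ (block s.2 .rev ++ block s.2 .aux))

theorem canon_rot (s : St Q) (k : K') : canon s ~r block s.2 k ++ rest s k := by
  have key : ∀ l l' : List (Sym Q), ∀ m, m = l' ++ l → l ++ l' ~r m := by
    rintro l l' _ rfl; exact List.isRotated_append
  cases k
  · have := key [.ctl s.1] (block s.2 .main ++ (block s.2 .rev ++ (block s.2 .aux ++ block s.2 .stack))) _ rfl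
    simpa [canon, rest] using this
  · have := key (.ctl s.1 :: block s.2 .main) (block s.2 .rev ++ (block s.2 .aux ++ block s.2 .stack)) _ rfl
    simpa [canon, rest] using this
  · have := key (.ctl s.1 :: (block s.2 .main ++ block s.2 .rev)) (block s.2 .aux ++ block s.2 .stack) _ rfl
    simpa [canon, rest] using this
  · have := key (.ctl s.1 :: (block s.2 .main ++ (block s.2 .rev ++ block s.2 .aux))) (block s.2 .stack) _ rfl
    simpa [canon, rest] using this

theorem rest_update (s : St Q) (k : K') (l : List Γ') :
    rest (s.1, Function.update s.2 k l) k = rest s k := by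
  cases k <;> simp [rest, block, Function.update]

theorem opn_notMem_rest (s : St Q) (k : K') : .opn k ∉ rest s k := by
  cases k <;> simp [rest, block]

theorem rot_unique {α : Type} {x : α} {l t q : List α} (h : l ~r x :: t) (hx : x ∉ t) (hq : q ~r l)
    {r : List α} (hr : q = x :: r) : r = t := by
  subst hr
  have h2 := hq.trans h
  obtain ⟨n, hn, h3⟩ := List.isRotated_iff_mod.1 h2
  rw [List.rotate_eq_drop_append_take hn] at h3
  cases n with
  | zero => simpa using h3
  | succ n =>
    rw [List.drop_succ_cons, List.take_succ_cons] at h3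
    have h4 : r.drop n = [] := by
      rcases hd : r.drop n with - | ⟨y, d⟩
      · rfl
      · rw [hd, List.cons_append] at h3
        injection h3 with h5 h6
        exfalso; apply hx; rw [← h6]; simp
    rw [h4] at h3
    simp at h3
    rw [← h3]
    have := List.drop_eq_nil_iff.1 h4
    exact (List.take_of_length_le this).symm

/-- Language of all words of rotations. -/
def rots (Q : Type) : Language (Act Q) := {w | ∀ a ∈ w, ∃ x, a = Act.rot x}

theorem mem_rots (w : List (Act Q)) : w ∈ rots Q ↔ ∀ a ∈ w, ∃ x, a = Act.rot x := Iff.rfl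

theorem reg_rots : (rots Q).IsRegular := by
  apply Language.IsRegular.of_finite_range_leftQuotient
  refine (Set.toFinite {0, rots Q}).subset ?_
  rintro _ ⟨x, rfl⟩
  by_cases h : x ∈ rots Q
  · right
    change _ = _
    ext y
    simp only [mem_leftQuotient, mem_rots] at *
    constructor
    · intro h a ha; exact h a (by simp [ha])
    · intro h2 a ha
      rcases List.mem_append.1 ha with ha | ha
      exacts [h a ha, h2 a ha]
  · left
    ext y
    simp only [mem_leftQuotient, Language.notMem_zero, iff_false]
    exact fun h2 => h fun a ha => h2 a (by simp [ha])

theorem run_rots {w : List (Act Q)} (hw : w ∈ rots Q) {q q' : List (Sym Q)} (h : Run w q q') :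
    q' ~r q := by
  induction w generalizing q with
  | nil => cases h; exact List.IsRotated.refl _
  | cons a w ih =>
    obtain ⟨r, h1, h2⟩ := h
    obtain ⟨x, rfl⟩ := hw a (by simp)
    have := ih (fun a ha => hw a (by simp [ha])) h2
    refine this.trans ?_
    cases q with
    | nil => simp [Act.out, Act.inp] at h1; rw [← h1]
    | cons y q =>
      simp [Act.out, Act.inp] at h1
      rw [← h1.2, h1.1]
      exact List.isRotated_append (l := q) (l' := [x])

theorem exists_run_rots {q q' : List (Sym Q)} (h : q ~r q') : ∃ w ∈ rots Q, Run w q q' := by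
  obtain ⟨n, rfl⟩ := h
  induction n generalizing q with
  | zero => exact ⟨[], fun a ha => by simp at ha, by simp [Run]⟩
  | succ n ih =>
    cases q with
    | nil => exact ⟨[], fun a ha => by simp at ha, by simp [Run]⟩
    | cons x q =>
      obtain ⟨w, hw, h⟩ := ih (q := q ++ [x])
      refine ⟨.rot x :: w, ?_, ?_⟩
      · intro a ha
        rcases List.mem_cons.1 ha with rfl | ha
        exacts [⟨x, rfl⟩, hw a ha]
      · rw [List.rotate_cons_succ]
        exact ⟨q ++ [x], by simp [Act.inp, Act.out], h⟩

/-! ### Definable relations -/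

def Definable (R : St Q → St Q → Prop) : Prop :=
  ∃ L : Language (Act Q), L.IsRegular ∧ ∀ s q, q ~r canon s →
    (∀ w ∈ L, ∀ q', Run w q q' → ∃ s', R s s' ∧ q' ~r canon s') ∧
    (∀ s', R s s' → ∃ w ∈ L, ∃ q', Run w q q' ∧ q' ~r canon s')

theorem Definable.congr {R R' : St Q → St Q → Prop} (h : Definable R) (hR : ∀ s s', R s s' ↔ R' s s') :
    Definable R' := by
  have : R = R' := by funext s s'; exact propext (hR s s')
  rwa [← this]

theorem Definable.comp {R R' : St Q → St Q → Prop} (h : Definable R) (h' : Definable R') :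
    Definable (fun s s' => ∃ t, R s t ∧ R' t s') := by
  obtain ⟨L, hL, H⟩ := h
  obtain ⟨L', hL', H'⟩ := h'
  refine ⟨L * L', reg_mul hL hL', fun s q hq => ⟨?_, ?_⟩⟩
  · intro w hw q' hr
    obtain ⟨a, ha, b, hb, rfl⟩ := Language.mem_mul.1 hw
    obtain ⟨r, h1, h2⟩ := (run_append _ _ _ _).1 hr
    obtain ⟨t, ht, hrt⟩ := (H s q hq).1 a ha r h1
    obtain ⟨s', hs', hq'⟩ := (H' t r hrt).1 b hb q' h2
    exact ⟨s', ⟨t, ht, hs'⟩, hq'⟩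
  · rintro s' ⟨t, ht, hs'⟩
    obtain ⟨a, ha, r, h1, hr⟩ := (H s q hq).2 t ht
    obtain ⟨b, hb, q', h2, hq'⟩ := (H' t r hr).2 s' hs'
    exact ⟨a ++ b, Language.mem_mul.2 ⟨a, ha, b, hb, rfl⟩, q', (run_append _ _ _ _).2 ⟨r, h1, h2⟩, hq'⟩

theorem Definable.or {R R' : St Q → St Q → Prop} (h : Definable R) (h' : Definable R') :
    Definable (fun s s' => R s s' ∨ R' s s') := by
  obtain ⟨L, hL, H⟩ := h
  obtain ⟨L', hL', H'⟩ := h'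
  refine ⟨L + L', hL.add hL', fun s q hq => ⟨?_, ?_⟩⟩
  · rintro w (hw | hw) q' hr
    · obtain ⟨s', h1, h2⟩ := (H s q hq).1 w hw q' hr
      exact ⟨s', Or.inl h1, h2⟩
    · obtain ⟨s', h1, h2⟩ := (H' s q hq).1 w hw q' hr
      exact ⟨s', Or.inr h1, h2⟩
  · rintro s' (hs | hs)
    · obtain ⟨w, hw, q', h1, h2⟩ := (H s q hq).2 s' hs
      exact ⟨w, Or.inl hw, q', h1, h2⟩
    · obtain ⟨w, hw, q', h1, h2⟩ := (H' s q hq).2 s' hs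
      exact ⟨w, Or.inr hw, q', h1, h2⟩

theorem definable_false : Definable (fun _ _ : St Q => False) :=
  ⟨0, reg_zero, fun _ _ _ => ⟨fun _ hw => absurd hw (Language.notMem_zero _), fun _ h => h.elim⟩⟩

theorem Definable.exists {ι : Type} [Finite ι] {R : ι → St Q → St Q → Prop} (h : ∀ i, Definable (R i)) :
    Definable (fun s s' => ∃ i, R i s s') := by
  classical
  cases nonempty_fintype ι
  have : ∀ t : Finset ι, Definable (fun s s' => ∃ i ∈ t, R i s s') := by
    intro t
    induction t using Finset.induction_on with
    | empty => exact definable_false.congr (by simp)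
    | insert a t _ ih => exact ((h a).or ih).congr (by simp)
  exact (this Finset.univ).congr (by simp)

theorem Definable.star {R : St Q → St Q → Prop} (h : Definable R) :
    Definable (Relation.ReflTransGen R) := by
  obtain ⟨L, hL, H⟩ := h
  refine ⟨L∗, reg_kstar hL, fun s q hq => ⟨?_, ?_⟩⟩
  · intro w hw q' hr
    obtain ⟨Ls, rfl, hmem⟩ := Language.mem_kstar.1 hw
    clear hw
    induction Ls generalizing s q with
    | nil => exact ⟨s, .refl, by cases hr; exact hq⟩
    | cons a Ls ih =>
      obtain ⟨r, h1, h2⟩ := (run_append _ _ _ _).1 hr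
      obtain ⟨t, ht, hrt⟩ := (H s q hq).1 a (hmem a (by simp)) r h1
      obtain ⟨s', hs', hq'⟩ := ih t r hrt (fun y hy => hmem y (by simp [hy])) h2
      exact ⟨s', .head ht hs', hq'⟩
  · intro s' hs'
    induction hs' using Relation.ReflTransGen.head_induction_on generalizing q with
    | refl => exact ⟨[], Language.nil_mem_kstar _, q, rfl, hq⟩
    | head ht _ ih =>
      obtain ⟨a, ha, r, h1, hr⟩ := (H _ q hq).2 _ ht
      obtain ⟨b, hb, q', h2, hq'⟩ := ih r hr
      refine ⟨a ++ b, ?_, q', (run_append _ _ _ _).2 ⟨r, h1, h2⟩, hq'⟩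
      exact mul_kstar_le_kstar (a := L) ⟨a, ha, b, hb, rfl⟩

theorem definable_prim (a : Act Q) (R : St Q → St Q → Prop)
    (h1 : ∀ s q r, q ~r canon s → q ++ a.out = a.inp ++ r → ∃ s', R s s' ∧ r ~r canon s')
    (h2 : ∀ s s', R s s' → ∃ q r, q ~r canon s ∧ q ++ a.out = a.inp ++ r ∧ r ~r canon s') :
    Definable R := by
  refine ⟨rots Q * sing [a], reg_mul reg_rots (reg_singleton _), fun s q hq => ⟨?_, ?_⟩⟩
  · intro w hw q' hr
    obtain ⟨b, hb, c, hc, rfl⟩ := Language.mem_mul.1 hw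
    obtain rfl : c = [a] := hc
    obtain ⟨r, h3, h4⟩ := (run_append _ _ _ _).1 hr
    obtain ⟨r', h5, rfl⟩ := h4
    exact h1 s r r' ((run_rots hb h3).trans hq) h5
  · intro s' hs'
    obtain ⟨q1, r, h3, h4, h5⟩ := h2 s s' hs'
    obtain ⟨w, hw, h6⟩ := exists_run_rots (hq.trans h3.symm)
    exact ⟨w ++ [a], Language.mem_mul.2 ⟨w, hw, [a], rfl, rfl⟩, r,
      (run_append _ _ _ _).2 ⟨q1, h6, r, h4, rfl⟩, h5⟩

theorem stack_unique (s : St Q) (k : K') {q r : List (Sym Q)} (hq : q ~r canon s)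
    (h : q = .opn k :: r) : r = (s.2 k).map .sy ++ .cls :: rest s k := by
  refine rot_unique (l := canon s) (x := .opn k) ?_ ?_ hq h
  · simpa [block] using canon_rot s k
  · have := opn_notMem_rest s k
    simp [this]

theorem canon_update (s : St Q) (k : K') (l : List Γ') :
    canon (s.1, Function.update s.2 k l) ~r .opn k :: (l.map .sy ++ .cls :: rest s k) := by
  have := canon_rot (s.1, Function.update s.2 k l) k
  rw [rest_update] at this
  simpa [block] using this

theorem canon_stack (s : St Q) (k : K') {l : List Γ'} (h : s.2 k = l) :
    canon s ~r .opn k :: (l.map .sy ++ .cls :: rest s k) := by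
  subst h
  simpa [block] using canon_rot s k

theorem snoc_rot {α : Type} (l l' : List α) {m : List α} (h : m ~r l' ++ l) : l ++ l' ~r m :=
  (List.isRotated_append).trans h.symm

theorem definable_push (k : K') (a : Γ') :
    Definable (fun s s' : St Q => s' = (s.1, Function.update s.2 k (a :: s.2 k))) := by
  refine definable_prim (.push k a) _ ?_ ?_
  · intro s q r hq h
    refine ⟨_, rfl, ?_⟩
    cases q with
    | nil =>
      have := hq.perm.length_eq
      simp [canon] at this
    | cons x q =>
      simp [Act.inp, Act.out] at h
      obtain ⟨rfl, rfl⟩ := h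
      have := stack_unique s k hq rfl
      subst this
      exact snoc_rot _ [_, _] (canon_update s k _)
  · rintro s s' rfl
    refine ⟨_, _, (canon_stack s k rfl).symm, rfl, ?_⟩
    exact snoc_rot _ [_, _] (canon_update s k _)

theorem definable_pop (k : K') (a : Γ') :
    Definable (fun s s' : St Q => ∃ l, s.2 k = a :: l ∧ s' = (s.1, Function.update s.2 k l)) := by
  refine definable_prim (.pop k a) _ ?_ ?_
  · intro s q r hq h
    cases q with
    | nil =>
      have := hq.perm.length_eq
      simp [canon] at this
    | cons x q =>
      simp [Act.inp, Act.out] at h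
      obtain ⟨rfl, h⟩ := h
      have := stack_unique s k hq rfl
      subst this
      rcases hl : s.2 k with - | ⟨b, l⟩
      · rw [hl] at h; simp at h
      · rw [hl] at h
        simp at h
        obtain ⟨rfl, rfl⟩ := h
        refine ⟨_, ⟨l, rfl, rfl⟩, ?_⟩
        have := snoc_rot (l.map .sy ++ .cls :: rest s k) [.opn k] (canon_update s k l)
        simpa using this
  · rintro s s' ⟨l, hl, rfl⟩
    refine ⟨_, _, (canon_stack s k hl).symm, rfl, ?_⟩
    exact snoc_rot _ [_] (canon_update s k _)

theorem definable_test (k : K') :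
    Definable (fun s s' : St Q => s.2 k = [] ∧ s' = s) := by
  refine definable_prim (.test k) _ ?_ ?_
  · intro s q r hq h
    cases q with
    | nil =>
      have := hq.perm.length_eq
      simp [canon] at this
    | cons x q =>
      simp [Act.inp, Act.out] at h
      obtain ⟨rfl, h⟩ := h
      have := stack_unique s k hq rfl
      subst this
      rcases hl : s.2 k with - | ⟨b, l⟩
      · rw [hl] at h
        simp at h
        subst h
        refine ⟨_, ⟨rfl, rfl⟩, ?_⟩
        exact snoc_rot (rest s k) [.opn k, .cls] (canon_stack s k hl)
      · rw [hl] at h; simp at h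
  · rintro s _ ⟨hl, hs⟩
    rw [hs]
    refine ⟨_, _, (canon_stack s k hl).symm, rfl, ?_⟩
    exact snoc_rot _ [_, _] (canon_stack s k hl)

theorem definable_chg (p p' : Q) :
    Definable (fun s s' : St Q => s.1 = p ∧ s' = (p', s.2)) := by
  refine definable_prim (.chg p p') _ ?_ ?_
  · intro s q r hq h
    cases q with
    | nil =>
      have := hq.perm.length_eq
      simp [canon] at this
    | cons x q =>
      simp [Act.inp, Act.out] at h
      obtain ⟨rfl, rfl⟩ := h
      have hp : s.1 = p := by
        have := hq.perm.mem_iff.1 (List.mem_cons_self (a := Sym.ctl p) (l := q))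
        simp [canon, block] at this
        exact this.symm
      subst hp
      refine ⟨_, ⟨rfl, rfl⟩, ?_⟩
      have := rot_unique (l := canon s) (x := .ctl s.1) (List.IsRotated.refl _) (by simp [block]) hq rfl
      subst this
      exact snoc_rot _ [_] (List.IsRotated.refl _)
  · rintro s s' ⟨rfl, rfl⟩
    refine ⟨_, _, (List.IsRotated.refl _), rfl, ?_⟩
    exact snoc_rot (block s.2 .main ++ (block s.2 .rev ++ (block s.2 .aux ++ block s.2 .stack))) [.ctl p'] (List.IsRotated.refl _)

end
end S14

namespace S14
open Turing Turing.ToPartrec Turing.PartrecToTM2 Language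
open scoped Computability

/-! ### Simulation of the TM2 machine by the queue machine -/

section
variable {Q : Type}

abbrev MCfg := TM2.Cfg (fun _ : K' => Γ') Λ' (Option Γ')
abbrev MStmt := TM2.Stmt (fun _ : K' => Γ') Λ' (Option Γ')

def absC (enc : Option Λ' → Option Γ' → Q) (c : MCfg) : St Q := (enc c.l c.var, c.stk)

theorem definable_head (k : K') (o : Option Γ') :
    Definable (fun s s' : St Q => (s.2 k).head? = o ∧ s' = s) := by
  cases o with
  | none => exact (definable_test k).congr (by simp [List.head?_eq_none_iff])
  | some a =>
    refine ((definable_pop k a).comp (definable_push k a)).congr ?_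
    rintro ⟨q, S⟩ s'
    constructor
    · rintro ⟨t, ⟨l, h1, rfl⟩, rfl⟩
      simp only at h1
      refine ⟨by simp [h1], ?_⟩
      simp [← h1]
    · rintro ⟨h1, rfl⟩
      obtain ⟨l, hl⟩ := List.head?_eq_some_iff.1 h1
      refine ⟨_, ⟨l, hl, rfl⟩, ?_⟩
      simp only at hl
      simp [← hl]

theorem definable_headPop (k : K') (o : Option Γ') :
    Definable (fun s s' : St Q => (s.2 k).head? = o ∧ s' = (s.1, Function.update s.2 k (s.2 k).tail)) := by
  cases o with
  | none =>
    refine (definable_test k).congr ?_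
    rintro ⟨q, S⟩ s'
    simp only [List.head?_eq_none_iff]
    constructor
    · rintro ⟨h1, rfl⟩
      refine ⟨h1, ?_⟩
      rw [h1, List.tail_nil, ← h1, Function.update_eq_self]
    · rintro ⟨h1, rfl⟩
      refine ⟨h1, ?_⟩
      rw [h1, List.tail_nil, ← h1, Function.update_eq_self]
  | some a =>
    refine (definable_pop k a).congr ?_
    rintro ⟨q, S⟩ s'
    simp only
    constructor
    · rintro ⟨l, h1, rfl⟩
      simp [h1]
    · rintro ⟨h1, rfl⟩
      obtain ⟨l, hl⟩ := List.head?_eq_some_iff.1 h1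
      exact ⟨l, hl, by simp [hl]⟩

theorem definable_stmt (enc : Option Λ' → Option Γ' → Q) (p : Q) (q : MStmt) (v : Option Γ') :
    Definable (fun s s' : St Q => s.1 = p ∧ s' = absC enc (TM2.stepAux q v s.2)) := by
  induction q generalizing v with
  | push k f q ih =>
    refine ((definable_push k (f v)).comp (ih v)).congr ?_
    rintro s s'
    simp [TM2.stepAux]
  | peek k f q ih =>
    refine (Definable.exists (fun o : Option Γ' => (definable_head k o).comp (ih (f v o)))).congr ?_
    rintro s s'
    simp [TM2.stepAux]
  | pop k f q ih =>
    refine (Definable.exists (fun o : Option Γ' => (definable_headPop k o).comp (ih (f v o)))).congr ?_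
    rintro s s'
    simp [TM2.stepAux]
  | load f q ih => exact ih (f v)
  | branch f q₁ q₂ ih₁ ih₂ =>
    cases h : f v
    · exact (ih₂ v).congr (by simp [TM2.stepAux, h])
    · exact (ih₁ v).congr (by simp [TM2.stepAux, h])
  | goto f =>
    exact definable_chg p (enc (some (f v)) v)
  | halt =>
    exact definable_chg p (enc none v)

def StepR (enc : Option Λ' → Option Γ' → Q) (T : Finset Λ') (s s' : St Q) : Prop :=
  ∃ l : {l // l ∈ T}, ∃ v : Option Γ', s.1 = enc (some l.1) v ∧ s' = absC enc (TM2.stepAux (tr l.1) v s.2)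

theorem definable_stepR (enc : Option Λ' → Option Γ' → Q) (T : Finset Λ') :
    Definable (StepR enc T) :=
  Definable.exists fun l => Definable.exists fun v => definable_stmt enc _ (tr l.1) v

def PopR (s s' : St Q) : Prop :=
  ∃ k : K', ∃ a : Γ', ∃ l, s.2 k = a :: l ∧ s' = (s.1, Function.update s.2 k l)

theorem definable_popR : Definable (PopR (Q := Q)) :=
  Definable.exists fun k => Definable.exists fun a => definable_pop k a

theorem popR_empty (q : Q) (S : K' → List Γ') :
    Relation.ReflTransGen PopR (q, S) (q, fun _ => []) := by
  have key : ∀ (l : List Γ') (S : K' → List Γ') (k : K'), S k = l →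
      Relation.ReflTransGen PopR (q, S) (q, Function.update S k []) := by
    intro l
    induction l with
    | nil =>
      intro S k h
      rw [← h, Function.update_eq_self]
    | cons a l ih =>
      intro S k h
      refine Relation.ReflTransGen.head (b := (q, Function.update S k l)) ⟨k, a, l, h, rfl⟩ ?_
      have := ih (Function.update S k l) k (by simp)
      simpa using this
  refine (key _ S .main rfl).trans ((key _ _ .rev rfl).trans ((key _ _ .aux rfl).trans
    ((key _ _ .stack rfl).trans ?_)))
  have : Function.update (Function.update (Function.update (Function.update S K'.main [])
      K'.rev []) K'.aux []) K'.stack [] = fun _ => [] := by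
    funext k
    cases k <;> simp [Function.update]
  rw [this]

theorem popR_fst {s s' : St Q} (h : Relation.ReflTransGen PopR s s') : s'.1 = s.1 := by
  induction h with
  | refl => rfl
  | tail _ h ih =>
    obtain ⟨k, a, l, _, rfl⟩ := h
    exact ih

end

abbrev QT (T : Finset Λ') : Type := Option {l // l ∈ T} × Option Γ'

open Classical in
noncomputable def encT (T : Finset Λ') (o : Option Λ') (v : Option Γ') : QT T :=
  (o.bind fun l => if h : l ∈ T then some ⟨l, h⟩ else none, v)

theorem encT_some (T : Finset Λ') (l : Λ') (h : l ∈ T) (v : Option Γ') :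
    encT T (some l) v = (some ⟨l, h⟩, v) := by
  simp [encT, h]

theorem reach_iff (T : Finset Λ') (d : Λ') (hT : @TM2.Supports _ _ _ _ ⟨d⟩ tr T) (c : MCfg)
    (hc : c.l ∈ Finset.insertNone T) (v : Option Γ') (S : K' → List Γ') :
    Relation.ReflTransGen (StepR (encT T) T) (absC (encT T) c) (encT T none v, S) ↔
      TM2.Reaches tr c ⟨none, v, S⟩ := by
  let _ : Inhabited Λ' := ⟨d⟩
  constructor
  · intro h
    generalize hx : absC (encT T) c = x at h
    induction h using Relation.ReflTransGen.head_induction_on generalizing c with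
    | refl =>
      obtain ⟨l, w, S'⟩ := c
      simp only [absC, Prod.mk.injEq] at hx
      obtain ⟨hx, rfl⟩ := hx
      cases l with
      | none =>
        obtain ⟨_, hw⟩ := Prod.mk.injEq .. ▸ hx
        cases hw
        exact .refl
      | some l =>
        rw [encT_some T l (Finset.some_mem_insertNone.1 hc)] at hx
        simp [encT] at hx
    | head h1 h2 ih =>
      subst hx
      obtain ⟨⟨l, hl⟩, w, h3, h4⟩ := h1
      obtain ⟨l', w', S'⟩ := c
      cases l' with
      | none =>
        simp only [absC] at h3
        rw [encT_some T l hl] at h3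
        simp [encT] at h3
      | some l' =>
        have hl' := Finset.some_mem_insertNone.1 hc
        simp only [absC] at h3
        rw [encT_some T l hl, encT_some T l' hl'] at h3
        simp only [Prod.mk.injEq, Option.some.injEq, Subtype.mk.injEq] at h3
        obtain ⟨rfl, rfl⟩ := h3
        refine Relation.ReflTransGen.head (b := TM2.stepAux (tr l') w' S') rfl ?_
        refine ih _ ?_ h4.symm
        exact TM2.step_supports tr hT (c := ⟨some l', w', S'⟩) rfl hc
  · intro h
    unfold TM2.Reaches at h
    generalize hx : (⟨none, v, S⟩ : MCfg) = x at h
    induction h using Relation.ReflTransGen.head_induction_on with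
    | refl => subst hx; exact .refl
    | head h1 h2 ih =>
      rename_i a b
      refine Relation.ReflTransGen.head (b := absC (encT T) b) ?_ (ih (TM2.step_supports tr hT h1 hc))
      obtain ⟨l', w', S'⟩ := a
      cases l' with
      | none => cases h1
      | some l' =>
        refine ⟨⟨l', Finset.some_mem_insertNone.1 hc⟩, w', rfl, ?_⟩
        cases h1
        rfl

theorem exists_queue (c : Code) : ∃ (Q : Type) (_ : Finite Q) (_ : DecidableEq Q)
    (L : Language (Act Q)) (tl F : List (Sym Q)), L.IsRegular ∧ tl ≠ [] ∧
    ∀ n, Halts c n ↔ ∃ w ∈ L, List.replicate n (.sy .bit0) ++ tl ++ w.flatMap Act.out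
      = w.flatMap Act.inp ++ F := by
  classical
  let T := codeSupp c Cont'.halt
  have hT := tr_supports c Cont'.halt
  let enc := encT T
  have hdef : Definable (fun s s' : St (QT T) => ∃ t, Relation.ReflTransGen (StepR enc T) s t ∧
      ∃ t', (∃ v : Option Γ', t.1 = enc none v ∧ t' = (enc none none, t.2)) ∧
        Relation.ReflTransGen PopR t' s') :=
    (definable_stepR enc T).star.comp
      ((Definable.exists fun v => definable_chg (enc none v) (enc none none)).comp definable_popR.star)
  obtain ⟨L, hL, H⟩ := hdef
  let κ0 : QT T := enc (some (trNormal c Cont'.halt)) none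
  let tl : List (Sym (QT T)) := [.sy .bit1, .sy .cons, .cls, .opn .rev, .cls, .opn .aux, .cls, .opn .stack, .cls,
    .ctl κ0, .opn .main]
  let F : List (Sym (QT T)) := canon (enc none none, fun _ => [])
  refine ⟨QT T, inferInstance, inferInstance, L * rots _, tl, F, reg_mul hL reg_rots, by simp [tl], fun n => ?_⟩
  set q0 : List (Sym (QT T)) := List.replicate n (.sy .bit0) ++ tl with hq0
  have hrot : q0 ~r canon (absC enc (initCfg c n)) := by
    have h1 : canon (absC enc (initCfg c n)) = [.ctl κ0, .opn .main] ++
        (List.replicate n (.sy .bit0) ++ [.sy .bit1, .sy .cons, .cls, .opn .rev, .cls, .opn .aux, .cls, .opn .stack, .cls]) := by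
      simp [canon, absC, initCfg, block, κ0]
    rw [h1]
    have := List.isRotated_append (l := (List.replicate n (.sy .bit0) ++ [.sy .bit1, .sy .cons, .cls, .opn .rev, .cls, .opn .aux, .cls, .opn .stack, .cls])) (l' := [Sym.ctl κ0, .opn .main])
    simpa [hq0, tl] using this
  have hcount : 1 ≤ q0.count .cls := by
    rw [hq0, List.count_append]
    have : 1 ≤ tl.count .cls := List.count_pos_iff.2 (by simp [tl])
    omega
  have hmain := H _ _ hrot
  have hinit : (initCfg c n).l ∈ Finset.insertNone T :=
    Finset.some_mem_insertNone.2 hT.1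
  constructor
  · rintro ⟨v, S, hr⟩
    obtain ⟨w, hw, q', hrun, hq'⟩ := hmain.2 (enc none none, fun _ => [])
      ⟨_, (reach_iff T _ hT _ hinit v S).2 hr, _, ⟨v, rfl, rfl⟩, popR_empty _ _⟩
    obtain ⟨w', hw', hrun'⟩ := exists_run_rots hq'
    refine ⟨w ++ w', Language.mem_mul.2 ⟨w, hw, w', hw', rfl⟩, run_eq _ _ _ ((run_append _ _ _ _).2 ⟨q', hrun, hrun'⟩)⟩
  · rintro ⟨w, hw, hrun⟩
    have := run_of_eq _ _ _ hcount hrun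
    obtain ⟨w, hw1, w', hw', rfl⟩ := Language.mem_mul.1 hw
    obtain ⟨q', h1, h2⟩ := (run_append _ _ _ _).1 this
    obtain ⟨s', ⟨⟨t1, S⟩, ht, t', ⟨v, hv, rfl⟩, _⟩, _⟩ := hmain.1 w hw1 q' h1
    simp only at hv
    subst hv
    exact ⟨v, S, (reach_iff T _ hT _ hinit v S).1 ht⟩

end S14

namespace S14
open Matrix

/-! ### The matrices -/

section
variable (m0 B C : ℕ) (dig g : ℕ → ℕ)

/-- Unit row vectors, indexed by natural numbers. -/
def ee (k n : ℕ) : Fin k → ℕ := fun j => if j.val = n then 1 else 0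

def row1 (k i : ℕ) : Fin k → ℕ :=
  if i = 0 then ee k 0 else if i ≤ m0 then ee k (i + 1) else if i = m0 + 1 then 0
    else if i = m0 + 2 then ee k (m0 + 2) else C • ee k (m0 + 3)

def row2 (k i : ℕ) : Fin k → ℕ :=
  if i = 0 then ee k 0 + ee k 1
    else if i ≤ m0 + 1 then dig (i - 1) • ee k (m0 + 2) + g (i - 1) • ee k (m0 + 3)
    else if i = m0 + 2 then B • ee k (m0 + 2) else ee k (m0 + 3)

def mat1 : Matrix (Fin (m0 + 4)) (Fin (m0 + 4)) ℕ := fun i => row1 m0 C (m0 + 4) i.val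
def mat2 : Matrix (Fin (m0 + 4)) (Fin (m0 + 4)) ℕ := fun i => row2 m0 B dig g (m0 + 4) i.val

theorem ut1 : MatrixUpperTriangular (mat1 m0 C) := by
  intro i j h
  have h' : j.val < i.val := h
  have hi := i.isLt
  simp only [mat1, row1]
  split_ifs <;> simp [ee] <;> omega

theorem ut2 : MatrixUpperTriangular (mat2 m0 B dig g) := by
  intro i j h
  have h' : j.val < i.val := h
  have hi := i.isLt
  have h1 : j.val ≠ m0 + 3 := by omega
  simp only [mat2, row2]
  split_ifs with h2 h3 h4
  · omega
  · have : j.val ≠ m0 + 2 := by omega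
    simp [ee, h1, this]
  · have : j.val ≠ m0 + 2 := by omega
    simp [ee, this]
  · simp [ee, h1]

theorem ee_vecMul {k : ℕ} (n : ℕ) (hn : n < k) (M : Matrix (Fin k) (Fin k) ℕ) :
    ee k n ᵥ* M = M ⟨n, hn⟩ := by
  have : ee k n = Pi.single ⟨n, hn⟩ 1 := by
    funext j
    simp [ee, Pi.single_apply, Fin.ext_iff]
  rw [this, Matrix.single_one_vecMul]
  rfl

abbrev cc : Fin (m0 + 4) → ℕ := ee (m0 + 4) 0
abbrev ss (j : ℕ) : Fin (m0 + 4) → ℕ := if j ≤ m0 then ee (m0 + 4) (j + 1) else 0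
abbrev vD : Fin (m0 + 4) → ℕ := ee (m0 + 4) (m0 + 2)
abbrev vH : Fin (m0 + 4) → ℕ := ee (m0 + 4) (m0 + 3)

theorem c1 : cc m0 ᵥ* mat1 m0 C = cc m0 := by
  rw [ee_vecMul 0 (by omega)]; simp [mat1, row1]
theorem s1 (j : ℕ) : ss m0 j ᵥ* mat1 m0 C = ss m0 (j + 1) := by
  unfold ss
  split_ifs with h1 h2 h2
  · rw [ee_vecMul _ (by omega)]; simp [mat1, row1]; omega
  · rw [ee_vecMul _ (by omega)]; simp [mat1, row1]
    rw [if_neg (by omega), if_pos (by omega)]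
  · omega
  · simp
theorem D1 : vD m0 ᵥ* mat1 m0 C = vD m0 := by
  rw [ee_vecMul _ (by omega)]; simp [mat1, row1]
theorem H1 : vH m0 ᵥ* mat1 m0 C = C • vH m0 := by
  rw [ee_vecMul _ (by omega)]; simp [mat1, row1]
theorem c2 : cc m0 ᵥ* mat2 m0 B dig g = cc m0 + ss m0 0 := by
  rw [ee_vecMul 0 (by omega)]; simp [mat2, row2]
theorem s2 (hdig : ∀ n, m0 < n → dig n = 0) (hg : ∀ n, m0 < n → g n = 0) (j : ℕ) :
    ss m0 j ᵥ* mat2 m0 B dig g = dig j • vD m0 + g j • vH m0 := by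
  unfold ss
  split_ifs with h1
  · rw [ee_vecMul _ (by omega)]; simp [mat2, row2]; omega
  · rw [hdig j (by omega), hg j (by omega)]; simp
theorem D2 : vD m0 ᵥ* mat2 m0 B dig g = B • vD m0 := by
  rw [ee_vecMul _ (by omega)]; simp [mat2, row2]
theorem H2 : vH m0 ᵥ* mat2 m0 B dig g = vH m0 := by
  rw [ee_vecMul _ (by omega)]; simp [mat2, row2]

/-- Matrix of a word with blocks `ns`. -/
def PhiL : List ℕ → Matrix (Fin (m0 + 4)) (Fin (m0 + 4)) ℕ
  | [] => 1
  | n :: ns => mat1 m0 C ^ n * mat2 m0 B dig g * PhiL ns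

variable {m0 B C dig g}

theorem pow_c (n : ℕ) : cc m0 ᵥ* (mat1 m0 C ^ n) = cc m0 := by
  induction n with
  | zero => simp
  | succ n ih => rw [pow_succ', ← Matrix.vecMul_vecMul, c1, ih]
theorem pow_s (n j : ℕ) : ss m0 j ᵥ* (mat1 m0 C ^ n) = ss m0 (j + n) := by
  induction n generalizing j with
  | zero => simp
  | succ n ih => rw [pow_succ', ← Matrix.vecMul_vecMul, s1, ih, add_assoc, add_comm 1 n]
theorem pow_D (n : ℕ) : vD m0 ᵥ* (mat1 m0 C ^ n) = vD m0 := by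
  induction n with
  | zero => simp
  | succ n ih => rw [pow_succ', ← Matrix.vecMul_vecMul, D1, ih]
theorem pow_H (n : ℕ) : vH m0 ᵥ* (mat1 m0 C ^ n) = C ^ n • vH m0 := by
  induction n with
  | zero => simp
  | succ n ih =>
    rw [pow_succ', ← Matrix.vecMul_vecMul, H1, Matrix.smul_vecMul, ih, smul_smul, pow_succ']

theorem phi_D (ns : List ℕ) : vD m0 ᵥ* PhiL m0 B C dig g ns = B ^ ns.length • vD m0 := by
  induction ns with
  | nil => simp [PhiL]
  | cons n ns ih =>
    rw [PhiL, ← Matrix.vecMul_vecMul, ← Matrix.vecMul_vecMul, pow_D, D2, Matrix.smul_vecMul, ih,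
      smul_smul, List.length_cons, pow_succ']
theorem phi_H (ns : List ℕ) : vH m0 ᵥ* PhiL m0 B C dig g ns = C ^ ns.sum • vH m0 := by
  induction ns with
  | nil => simp [PhiL]
  | cons n ns ih =>
    rw [PhiL, ← Matrix.vecMul_vecMul, ← Matrix.vecMul_vecMul, pow_H, Matrix.smul_vecMul, H2,
      Matrix.smul_vecMul, ih, smul_smul, List.sum_cons, pow_add]

theorem phi_c (hdig : ∀ n, m0 < n → dig n = 0) (hg : ∀ n, m0 < n → g n = 0) (ns : List ℕ) (x y : ℕ) :
    (cc m0 + ss m0 0 + x • vD m0 + y • vH m0) ᵥ* PhiL m0 B C dig g ns =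
      cc m0 + ss m0 0 + (ns.foldl (fun a n => B * a + dig n) x) • vD m0
        + (ns.foldl (fun a n => C ^ n * a + g n) y) • vH m0 := by
  induction ns generalizing x y with
  | nil => simp [PhiL]
  | cons n ns ih =>
    rw [List.foldl_cons, List.foldl_cons, ← ih, PhiL, ← Matrix.vecMul_vecMul, ← Matrix.vecMul_vecMul]
    congr 1
    simp only [Matrix.add_vecMul, Matrix.smul_vecMul, pow_c, pow_s, pow_D, pow_H, c2, D2, H2,
      s2 m0 B dig g hdig hg, zero_add]
    module

/-- The four invariants. -/
def D0 (B : ℕ) (dig : ℕ → ℕ) (ns : List ℕ) : ℕ := ns.foldl (fun a n => B * a + dig n) 0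
def V0 (C : ℕ) (g : ℕ → ℕ) (ns : List ℕ) : ℕ := ns.foldl (fun a n => C ^ n * a + g n) 0

theorem row_c (hdig : ∀ n, m0 < n → dig n = 0) (hg : ∀ n, m0 < n → g n = 0) (ns : List ℕ) :
    cc m0 ᵥ* (mat2 m0 B dig g * PhiL m0 B C dig g ns) =
      cc m0 + ss m0 0 + D0 B dig ns • vD m0 + V0 C g ns • vH m0 := by
  rw [← Matrix.vecMul_vecMul, c2, D0, V0, ← phi_c hdig hg]
  simp
theorem row_s (hdig : ∀ n, m0 < n → dig n = 0) (hg : ∀ n, m0 < n → g n = 0) (ns : List ℕ) (j : ℕ) :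
    ss m0 j ᵥ* (mat2 m0 B dig g * PhiL m0 B C dig g ns) =
      (dig j * B ^ ns.length) • vD m0 + (g j * C ^ ns.sum) • vH m0 := by
  rw [← Matrix.vecMul_vecMul, s2 m0 B dig g hdig hg, Matrix.add_vecMul, Matrix.smul_vecMul,
    Matrix.smul_vecMul, phi_D, phi_H, smul_smul, smul_smul]
theorem row_D (ns : List ℕ) :
    vD m0 ᵥ* (mat2 m0 B dig g * PhiL m0 B C dig g ns) = (B * B ^ ns.length) • vD m0 := by
  rw [← Matrix.vecMul_vecMul, D2, Matrix.smul_vecMul, phi_D, smul_smul]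
theorem row_H (ns : List ℕ) :
    vH m0 ᵥ* (mat2 m0 B dig g * PhiL m0 B C dig g ns) = C ^ ns.sum • vH m0 := by
  rw [← Matrix.vecMul_vecMul, H2, phi_H]

theorem mat_eq_iff (hB : 2 ≤ B) (hC : 2 ≤ C)
    (hdig : ∀ n, m0 < n → dig n = 0) (hg : ∀ n, m0 < n → g n = 0) (ns ns' : List ℕ) :
    mat2 m0 B dig g * PhiL m0 B C dig g ns = mat2 m0 B dig g * PhiL m0 B C dig g ns' ↔
      ns.length = ns'.length ∧ ns.sum = ns'.sum ∧ D0 B dig ns = D0 B dig ns' ∧ V0 C g ns = V0 C g ns' := by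
  constructor
  · intro h
    have h1 := row_D (B := B) (C := C) (dig := dig) (g := g) (m0 := m0) ns
    rw [h, row_D] at h1
    have h1' := congrFun h1 ⟨m0 + 2, by omega⟩
    have h2 := row_H (B := B) (C := C) (dig := dig) (g := g) (m0 := m0) ns
    rw [h, row_H] at h2
    have h2' := congrFun h2 ⟨m0 + 3, by omega⟩
    have h3 := row_c (B := B) (C := C) hdig hg ns
    rw [h, row_c hdig hg] at h3
    have h3' := congrFun h3 ⟨m0 + 2, by omega⟩
    have h4' := congrFun h3 ⟨m0 + 3, by omega⟩
    simp [ee] at h1' h2' h3' h4'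
    refine ⟨?_, ?_, h3'.symm, h4'.symm⟩
    · rcases h1' with h | h
      · exact (Nat.pow_right_injective hB h).symm
      · omega
    · exact (Nat.pow_right_injective hC h2').symm
  · rintro ⟨h1, h2, h3, h4⟩
    have key : ∀ (M N : Matrix (Fin (m0 + 4)) (Fin (m0 + 4)) ℕ),
        cc m0 ᵥ* M = cc m0 ᵥ* N → (∀ j, ss m0 j ᵥ* M = ss m0 j ᵥ* N) → vD m0 ᵥ* M = vD m0 ᵥ* N →
        vH m0 ᵥ* M = vH m0 ᵥ* N → M = N := by
      intro M N hc hs hD hH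
      refine funext fun i => ?_
      obtain ⟨i, hi⟩ := i
      rw [← ee_vecMul i hi M, ← ee_vecMul i hi N]
      rcases Nat.eq_zero_or_pos i with rfl | hi0
      · exact hc
      by_cases h1 : i ≤ m0 + 1
      · have := hs (i - 1)
        unfold ss at this
        rwa [if_pos (by omega), Nat.sub_add_cancel hi0] at this
      by_cases h2 : i = m0 + 2
      · subst h2; exact hD
      · obtain rfl : i = m0 + 3 := by omega
        exact hH
    apply key
    · rw [row_c hdig hg, row_c hdig hg, h3, h4]
    · intro j; rw [row_s hdig hg, row_s hdig hg, h1, h2]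
    · rw [row_D, row_D, h1]
    · rw [row_H, row_H, h2]

theorem mat_ne_zero (hC : 2 ≤ C) (ns : List ℕ) :
    mat2 m0 B dig g * PhiL m0 B C dig g ns ≠ 0 := by
  intro h
  have h2 := row_H (B := B) (C := C) (dig := dig) (g := g) (m0 := m0) ns
  rw [h] at h2
  have h2' := congrFun h2 ⟨m0 + 3, by omega⟩
  have h3 : 0 < C ^ ns.sum := Nat.pow_pos (by omega)
  simp only [Matrix.vecMul_zero, Pi.zero_apply, Pi.smul_apply, ee, if_true, smul_eq_mul] at h2'
  omega

/-! ### Words -/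

def encW (ns : List ℕ) : List Bool := ns.flatMap fun n => List.replicate n false ++ [true]

theorem encW_append (a b : List ℕ) : encW (a ++ b) = encW a ++ encW b := by
  simp [encW]

theorem exists_encW (w : List Bool) : ∃ ns, w ++ [true] = encW ns := by
  induction w with
  | nil => exact ⟨[0], rfl⟩
  | cons b w ih =>
    obtain ⟨ns, h⟩ := ih
    cases b with
    | true => exact ⟨0 :: ns, by simp [h, encW]⟩
    | false =>
      cases ns with
      | nil => simp [encW] at h
      | cons n ns => exact ⟨(n + 1) :: ns, by simp [h, encW, List.replicate_succ]⟩

theorem phi_enc (φ : FreeMonoid Bool →* Matrix (Fin (m0 + 4)) (Fin (m0 + 4)) ℕ)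
    (h1 : φ (FreeMonoid.of false) = mat1 m0 C) (h2 : φ (FreeMonoid.of true) = mat2 m0 B dig g)
    (ns : List ℕ) : φ (FreeMonoid.ofList (encW ns)) = PhiL m0 B C dig g ns := by
  induction ns with
  | nil => exact map_one φ
  | cons n ns ih =>
    have hr : ∀ n, φ (FreeMonoid.ofList (List.replicate n false)) = mat1 m0 C ^ n := by
      intro n
      induction n with
      | zero => exact map_one φ
      | succ n ih =>
        rw [List.replicate_succ, FreeMonoid.ofList_cons, map_mul, ih, h1, pow_succ']
    rw [PhiL, ← ih, ← hr n, ← h2, ← map_mul, ← map_mul]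
    congr 1
    
theorem mem_closure_iff {k : ℕ} (φ : FreeMonoid Bool →* Matrix (Fin k) (Fin k) ℕ)
    (N : Matrix (Fin k) (Fin k) ℕ) :
    N ∈ Submonoid.closure ({φ (FreeMonoid.of false), φ (FreeMonoid.of true)} : Set (Matrix (Fin k) (Fin k) ℕ)) ↔
      ∃ w, N = φ (FreeMonoid.ofList w) := by
  constructor
  · intro h
    induction h using Submonoid.closure_induction with
    | mem x hx =>
      rcases hx with rfl | rfl
      · exact ⟨[false], rfl⟩
      · exact ⟨[true], rfl⟩
    | one => exact ⟨[], (map_one φ).symm⟩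
    | mul x y _ _ hx hy =>
      obtain ⟨a, rfl⟩ := hx
      obtain ⟨b, rfl⟩ := hy
      exact ⟨a ++ b, by rw [FreeMonoid.ofList_append, map_mul]⟩
  · rintro ⟨w, rfl⟩
    induction w with
    | nil => rw [FreeMonoid.ofList_nil, map_one]; exact one_mem _
    | cons b w ih =>
      rw [FreeMonoid.ofList_cons, map_mul]
      refine mul_mem (Submonoid.subset_closure ?_) ih
      cases b <;> simp

end
end S14

namespace S14

/-! ### Paths in a finite graph encoded by the matrices -/

section
variable {F : Type} (src tgt : F → ℕ)

/-- `p` is a path from `s` to `t`. -/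
def Path : ℕ → List F → ℕ → Prop
  | s, [], t => s = t
  | s, f :: p, t => src f = s ∧ Path (tgt f) p t

/-- `p` is a path from `s` ending at its first visit of `0`. -/
def PathZ : ℕ → List F → Prop
  | s, [] => s = 0
  | s, f :: p => s ≠ 0 ∧ src f = s ∧ PathZ (tgt f) p

theorem PathZ.path {src tgt : F → ℕ} {s : ℕ} {p : List F} (h : PathZ src tgt s p) : Path src tgt s p 0 := by
  induction p generalizing s with
  | nil => exact h
  | cons f p ih => exact ⟨h.2.1, ih h.2.2⟩

/-- Difference of two base-`B` folds. -/
def foldD (B : ℤ) (dig : ℕ → ℕ) : ℤ → List ℕ → List ℕ → ℤ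
  | d, n :: ns, n' :: ns' => foldD B dig (B * d + dig n - dig n') ns ns'
  | d, _, _ => d

theorem foldD_eq (B : ℕ) (dig : ℕ → ℕ) (ns ns' : List ℕ) (h : ns.length = ns'.length) (x y : ℕ) :
    ((ns.foldl (fun a n => B * a + dig n) x : ℕ) : ℤ) - (ns'.foldl (fun a n => B * a + dig n) y : ℕ)
      = foldD B dig (x - y) ns ns' := by
  induction ns generalizing ns' x y with
  | nil => cases ns' with
    | nil => simp [foldD]
    | cons => simp at h
  | cons n ns ih => cases ns' with
    | nil => simp at h
    | cons n' ns' =>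
      simp only [List.length_cons, Nat.add_right_cancel_iff] at h
      rw [List.foldl_cons, List.foldl_cons, ih _ h, foldD]
      congr 1
      push_cast
      ring

theorem D0_iff (B : ℕ) (dig : ℕ → ℕ) (ns ns' : List ℕ) (h : ns.length = ns'.length) :
    D0 B dig ns = D0 B dig ns' ↔ foldD B dig 0 ns ns' = 0 := by
  have := foldD_eq B dig ns ns' h 0 0
  simp only [Nat.cast_zero, sub_zero] at this
  rw [← this, D0, D0]
  omega

variable {src tgt}

theorem foldD_path (B : ℤ) (lX lY : F → ℕ) (dg : ℕ → ℕ)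
    (hd : ∀ f, (dg (lY f) : ℤ) = dg (lX f) + B * src f - tgt f)
    {s t : ℕ} {p : List F} (h : Path src tgt s p t) (ns ns' : List ℕ) :
    foldD B dg s (p.map lX ++ ns) (p.map lY ++ ns') = foldD B dg t ns ns' := by
  induction p generalizing s with
  | nil => obtain rfl : s = t := h; rfl
  | cons f p ih =>
    obtain ⟨rfl, h⟩ := h
    rw [← ih h]
    simp only [List.map_cons, List.cons_append, foldD, hd]
    congr 1
    ring

/-- Local analysis of one step. -/
theorem step_analysis (S N : ℕ) (B : ℤ) (hB : (N + 1) * (2 * S + 1) + S + 1 ≤ B)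
    (hs : ∀ f, src f ≤ S) (ht : ∀ f, tgt f ≤ S) (ix : F → ℕ) (hix : Function.Injective ix)
    (hN : ∀ f, ix f < N) (lX lY : F → ℕ) (dg : ℕ → ℕ)
    (hX : ∀ f, (dg (lX f) : ℤ) = (ix f + 1) * (2 * S + 1))
    (hY : ∀ f, (dg (lY f) : ℤ) = (ix f + 1) * (2 * S + 1) + B * src f - tgt f)
    (h0 : ∀ n, (∀ f, n ≠ lX f) → (∀ f, n ≠ lY f) → dg n = 0) :
    (∀ (d : ℤ) n n', |B * d + dg n - dg n'| ≤ S → |d| ≤ S) ∧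
    (∀ (s : ℕ) n n', s ≠ 0 → |B * s + dg n - dg n'| ≤ S →
      ∃ f, n = lX f ∧ n' = lY f ∧ src f = s ∧ B * s + dg n - dg n' = tgt f) := by
  have hcl : ∀ n, ∃ α β : ℤ, (dg n : ℤ) = B * α + β ∧ 0 ≤ α ∧ α ≤ S ∧ 0 ≤ β ∧ β ≤ N * (2 * S + 1) ∧
      ((α = 0 ∧ β = 0) ∨ (∃ f, n = lX f ∧ α = 0 ∧ β = (ix f + 1) * (2 * S + 1)) ∨
        (∃ f, n = lY f ∧ α = src f ∧ β = (ix f + 1) * (2 * S + 1) - tgt f)) := by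
    intro n
    by_cases h1 : ∃ f, n = lX f
    · obtain ⟨f, rfl⟩ := h1
      have hN' : (ix f + 1 : ℤ) ≤ N := by exact_mod_cast hN f
      refine ⟨0, (ix f + 1) * (2 * S + 1), by rw [hX]; ring, le_rfl, by positivity, by positivity, ?_,
        .inr (.inl ⟨f, rfl, rfl, rfl⟩)⟩
      gcongr
    by_cases h2 : ∃ f, n = lY f
    · obtain ⟨f, rfl⟩ := h2
      have hN' : (ix f + 1 : ℤ) ≤ N := by exact_mod_cast hN f
      have ht' : (tgt f : ℤ) ≤ S := by exact_mod_cast ht f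
      have hs' : (src f : ℤ) ≤ S := by exact_mod_cast hs f
      refine ⟨src f, (ix f + 1) * (2 * S + 1) - tgt f, by rw [hY]; ring, by positivity, hs', ?_, ?_,
        .inr (.inr ⟨f, rfl, rfl, rfl⟩)⟩
      · nlinarith [Int.natCast_nonneg (ix f), Int.natCast_nonneg S]
      · have : ((ix f : ℤ) + 1) * (2 * S + 1) ≤ N * (2 * S + 1) := by gcongr
        have := Int.natCast_nonneg (tgt f)
        linarith
    · push Not at h1 h2
      refine ⟨0, 0, by rw [h0 n h1 h2]; simp, le_rfl, by positivity, le_rfl, by positivity, .inl ⟨rfl, rfl⟩⟩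
  -- the leading part must vanish
  have hlead : ∀ (e b : ℤ), |b| ≤ N * (2 * S + 1) → |B * e + b| ≤ S → e = 0 := by
    intro e b hb h
    rw [abs_le] at hb h
    have hS := Int.natCast_nonneg S
    have hBpos : 0 < B := by
      have : (0 : ℤ) ≤ (N + 1) * (2 * S + 1) := by positivity
      linarith
    by_contra he
    rcases lt_or_gt_of_ne he with he | he
    · have : e ≤ -1 := by omega
      nlinarith
    · have : 1 ≤ e := by omega
      nlinarith
  constructor
  · intro d n n' h
    obtain ⟨α, β, e1, a1, a2, b1, b2, -⟩ := hcl n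
    obtain ⟨α', β', e1', a1', a2', b1', b2', -⟩ := hcl n'
    have := hlead (d + α - α') (β - β') (by rw [abs_le]; constructor <;> linarith) (by
      convert h using 2; rw [e1, e1']; ring)
    rw [abs_le]; constructor <;> linarith
  · intro s n n' hs0 h
    obtain ⟨α, β, e1, a1, a2, b1, b2, hc⟩ := hcl n
    obtain ⟨α', β', e1', a1', a2', b1', b2', hc'⟩ := hcl n'
    have hz := hlead (s + α - α') (β - β') (by rw [abs_le]; constructor <;> linarith) (by
      convert h using 2; rw [e1, e1']; ring)
    have hval : B * s + dg n - dg n' = β - β' := by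
      rw [e1, e1', show (β - β' : ℤ) = B * (s + α - α') + (β - β') by rw [hz]; ring]; ring
    rw [hval, abs_le] at h
    have hsS : (1 : ℤ) ≤ s := by exact_mod_cast Nat.one_le_iff_ne_zero.2 hs0
    have key : ∀ f f', |((ix f : ℤ) + 1) * (2 * S + 1) - (ix f' + 1) * (2 * S + 1)| ≤ 2 * S → f = f' := by
      intro f f' hh
      apply hix
      rw [abs_le] at hh
      have hS := Int.natCast_nonneg S
      by_contra hne
      rcases lt_or_gt_of_ne hne with h1 | h1
      · have : (ix f : ℤ) + 1 ≤ ix f' := by exact_mod_cast h1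
        nlinarith
      · have : (ix f' : ℤ) + 1 ≤ ix f := by exact_mod_cast h1
        nlinarith
    rcases hc' with ⟨x, -⟩ | ⟨f, -, x, -⟩ | ⟨f', hn', ha', hb'⟩
    · omega
    · omega
    have ht' : (tgt f' : ℤ) ≤ S := by exact_mod_cast ht f'
    have ht0 := Int.natCast_nonneg (tgt f')
    rcases hc with ⟨x, y⟩ | ⟨f, hn, ha, hb⟩ | ⟨f, hn, ha, hb⟩
    · exfalso
      nlinarith [Int.natCast_nonneg (ix f'), Int.natCast_nonneg S]
    · have : f = f' := key f f' (by rw [abs_le]; constructor <;> linarith)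
      subst this
      refine ⟨f, hn, hn', by omega, ?_⟩
      rw [hval, hb, hb']; ring
    · have ht1 : (tgt f : ℤ) ≤ S := by exact_mod_cast ht f
      have ht2 := Int.natCast_nonneg (tgt f)
      have : f = f' := key f f' (by rw [abs_le]; constructor <;> linarith)
      subst this
      omega

theorem exists_pathZ (S : ℕ) (B : ℤ) (lX lY : F → ℕ) (dg : ℕ → ℕ)
    (H1 : ∀ (d : ℤ) n n', |B * d + dg n - dg n'| ≤ S → |d| ≤ S)
    (H2 : ∀ (s : ℕ) n n', s ≠ 0 → |B * s + dg n - dg n'| ≤ S →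
      ∃ f, n = lX f ∧ n' = lY f ∧ src f = s ∧ B * s + dg n - dg n' = tgt f)
    (s : ℕ) (ns ns' : List ℕ) (hlen : ns.length = ns'.length) (h : foldD B dg s ns ns' = 0) :
    ∃ p t t', PathZ src tgt s p ∧ ns = p.map lX ++ t ∧ ns' = p.map lY ++ t' := by
  have bd : ∀ (ns ns' : List ℕ) (d : ℤ), foldD B dg d ns ns' = 0 → |d| ≤ S := by
    intro ns
    induction ns with
    | nil => intro ns' d h; rw [foldD] at h <;> simp [h]
    | cons n ns ih =>
      intro ns' d h
      cases ns' with
      | nil => rw [foldD] at h <;> simp [h]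
      | cons n' ns' => exact H1 _ _ _ (ih _ _ h)
  induction ns generalizing s ns' with
  | nil =>
    cases ns' with
    | nil =>
      have : s = 0 := by simpa [foldD] using h
      exact ⟨[], [], [], this, rfl, rfl⟩
    | cons => simp at hlen
  | cons n ns ih =>
    cases ns' with
    | nil => simp at hlen
    | cons n' ns' =>
      rcases eq_or_ne s 0 with rfl | hs
      · exact ⟨[], n :: ns, n' :: ns', rfl, rfl, rfl⟩
      · obtain ⟨f, rfl, rfl, hsf, hd⟩ := H2 s n n' hs (bd _ _ _ h)
        rw [foldD, hd] at h
        obtain ⟨p, t, t', hp, rfl, rfl⟩ := ih (tgt f) ns' (by simpa using hlen) h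
        exact ⟨f :: p, t, t', ⟨hs, hsf, hp⟩, rfl, rfl⟩

/-- Base-`C` value. -/
def val (C : ℕ) (l : List ℕ) : ℕ := Nat.ofDigits C l.reverse

theorem V0_eq (C : ℕ) (h : ℕ → List ℕ) (hl : ∀ n, (h n).length = n) (ns : List ℕ) (l : List ℕ) :
    ns.foldl (fun a n => C ^ n * a + val C (h n)) (val C l) = val C (l ++ ns.flatMap h) := by
  induction ns generalizing l with
  | nil => simp
  | cons n ns ih =>
    rw [List.foldl_cons, List.flatMap_cons, ← List.append_assoc, ← ih]
    congr 1
    simp [val, Nat.ofDigits_append, hl]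
    ring

theorem val_inj {C : ℕ} (hC : 2 ≤ C) {l l' : List ℕ} (hlen : l.length = l'.length)
    (h1 : ∀ d ∈ l, d < C) (h2 : ∀ d ∈ l', d < C) (h : val C l = val C l') : l = l' := by
  have := Nat.ofDigits_inj_of_len_eq (b := C) (by omega) (by simpa using hlen)
    (by simpa using h1) (by simpa using h2) h
  simpa using this

theorem reduction [Finite F] (src tgt : F → ℕ) (XW YW : F → List ℕ) (C : ℕ) (hC : 2 ≤ C)
    (hX : ∀ f, ∀ d ∈ XW f, d < C) (hY : ∀ f, ∀ d ∈ YW f, d < C)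
    (hinj : Function.Injective (Sum.elim (fun f => (XW f).length) (fun f => (YW f).length))) :
    ∃ (k : ℕ) (M1 M2 : Matrix (Fin k) (Fin k) ℕ),
      0 < k ∧ MatrixUpperTriangular M1 ∧ MatrixUpperTriangular M2 ∧
      ∀ φ : FreeMonoid Bool →* Matrix (Fin k) (Fin k) ℕ,
        φ (FreeMonoid.of false) = M1 →
        φ (FreeMonoid.of true) = M2 →
        ∃ cond : List Bool × List Bool → Prop, (cond = (fun uv : List Bool × List Bool =>
          ∃ N1 ∈ Submonoid.closure ({M1, M2} : Set (Matrix (Fin k) (Fin k) ℕ)),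
            ∃ N2 ∈ Submonoid.closure ({M1, M2} : Set (Matrix (Fin k) (Fin k) ℕ)),
            φ (FreeMonoid.ofList uv.1) * N1 = φ (FreeMonoid.ofList uv.2) * N2 ∧
            φ (FreeMonoid.ofList uv.1) * N1 ≠ 0)) ∧
        ∀ (p0 : List F) (s : ℕ), Path src tgt 0 p0 s →
          (cond (true :: encW (p0.map fun f => (XW f).length), true :: encW (p0.map fun f => (YW f).length)) →
            ∃ p t t', PathZ src tgt s p ∧ (p0 ++ p).flatMap XW ++ t = (p0 ++ p).flatMap YW ++ t') ∧
          (∀ p, PathZ src tgt s p → (p0 ++ p).flatMap XW = (p0 ++ p).flatMap YW →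
            cond (true :: encW (p0.map fun f => (XW f).length),
              true :: encW (p0.map fun f => (YW f).length))) := by
  obtain ⟨N, ⟨eF⟩⟩ := Finite.exists_equiv_fin F
  set ix : F → ℕ := fun f => (eF f).val with hixdef
  have hix : Function.Injective ix := fun a b h => eF.injective (Fin.ext h)
  have hN : ∀ f, ix f < N := fun f => (eF f).isLt
  have bdd : ∀ fn : F → ℕ, ∃ b, ∀ f, fn f ≤ b := fun fn => by
    obtain ⟨b, hb⟩ := (Set.finite_range fn).bddAbove
    exact ⟨b, fun f => hb ⟨f, rfl⟩⟩
  obtain ⟨S, hS⟩ := bdd (fun f => src f + tgt f)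
  have hs : ∀ f, src f ≤ S := fun f => le_trans (Nat.le_add_right _ _) (hS f)
  have ht : ∀ f, tgt f ≤ S := fun f => le_trans (Nat.le_add_left _ _) (hS f)
  set lX : F → ℕ := fun f => (XW f).length with hlX
  set lY : F → ℕ := fun f => (YW f).length with hlY
  obtain ⟨m0, hm0⟩ := bdd (fun f => lX f + lY f)
  set B : ℕ := (N + 1) * (2 * S + 1) + S + 2 with hBdef
  have hB : 2 ≤ B := by omega
  set a : F → ℕ := fun f => (ix f + 1) * (2 * S + 1) with ha
  set dig : ℕ → ℕ := Function.extend (Sum.elim lX lY) (Sum.elim a fun f => a f + B * src f - tgt f)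
    (fun _ => 0) with hdigdef
  set h : ℕ → List ℕ := Function.extend (Sum.elim lX lY) (Sum.elim XW YW) (fun n => List.replicate n 0)
    with hhdef
  have dX : ∀ f, dig (lX f) = a f := fun f => hinj.extend_apply _ _ (Sum.inl f)
  have dY : ∀ f, dig (lY f) = a f + B * src f - tgt f := fun f => hinj.extend_apply _ _ (Sum.inr f)
  have nex : ∀ n, (∀ f, n ≠ lX f) → (∀ f, n ≠ lY f) → ¬ ∃ x, Sum.elim lX lY x = n := by
    rintro n h1 h2 ⟨f | f, h⟩
    · exact h1 f h.symm
    · exact h2 f h.symm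
  have d0 : ∀ n, (∀ f, n ≠ lX f) → (∀ f, n ≠ lY f) → dig n = 0 := fun n h1 h2 =>
    Function.extend_apply' _ _ _ (nex n h1 h2)
  have hhX : ∀ f, h (lX f) = XW f := fun f => hinj.extend_apply _ _ (Sum.inl f)
  have hhY : ∀ f, h (lY f) = YW f := fun f => hinj.extend_apply _ _ (Sum.inr f)
  have hh0 : ∀ n, (∀ f, n ≠ lX f) → (∀ f, n ≠ lY f) → h n = List.replicate n 0 := fun n h1 h2 =>
    Function.extend_apply' _ _ _ (nex n h1 h2)
  have hh : ∀ n, (h n).length = n ∧ ∀ d ∈ h n, d < C := by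
    intro n
    by_cases h1 : ∃ f, n = lX f
    · obtain ⟨f, rfl⟩ := h1
      rw [hhX]; exact ⟨rfl, hX f⟩
    by_cases h2 : ∃ f, n = lY f
    · obtain ⟨f, rfl⟩ := h2
      rw [hhY]; exact ⟨rfl, hY f⟩
    push Not at h1 h2
    rw [hh0 n h1 h2]
    refine ⟨by simp, fun d hd => ?_⟩
    rw [List.eq_of_mem_replicate hd]; omega
  have big : ∀ n, m0 < n → (∀ f, n ≠ lX f) ∧ (∀ f, n ≠ lY f) := by
    intro n hn
    constructor <;> intro f <;> have := hm0 f <;> omega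
  have hdig : ∀ n, m0 < n → dig n = 0 := fun n hn => d0 n (big n hn).1 (big n hn).2
  set g : ℕ → ℕ := fun n => val C (h n) with hgdef
  have hg : ∀ n, m0 < n → g n = 0 := fun n hn => by
    simp only [hgdef]
    rw [hh0 n (big n hn).1 (big n hn).2]
    simp [val, Nat.ofDigits_replicate_zero]
  have haS : ∀ f, S ≤ a f := fun f => by
    simp only [ha]; nlinarith [Nat.zero_le (ix f), Nat.zero_le S, Nat.zero_le (ix f * S)]
  have dXz : ∀ f, (dig (lX f) : ℤ) = (ix f + 1) * (2 * S + 1) := fun f => by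
    rw [dX]; simp only [ha]; push_cast; ring
  have dYz : ∀ f, (dig (lY f) : ℤ) = (ix f + 1) * (2 * S + 1) + (B : ℤ) * src f - tgt f := fun f => by
    rw [dY, Nat.cast_sub (le_trans (le_trans (ht f) (haS f)) (Nat.le_add_right _ _))]
    simp only [ha]; push_cast; ring
  have dYX : ∀ f, (dig (lY f) : ℤ) = dig (lX f) + (B : ℤ) * src f - tgt f := fun f => by rw [dYz, dXz]
  obtain ⟨H1, H2⟩ := step_analysis (src := src) (tgt := tgt) S N B (by rw [hBdef]; push_cast; linarith)
    hs ht ix hix hN lX lY dig dXz dYz d0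
  have hV : ∀ ns, V0 C g ns = val C (ns.flatMap h) := fun ns => by
    have := V0_eq C h (fun n => (hh n).1) ns []
    simpa [V0, val, hgdef] using this
  have hlenh : ∀ ns : List ℕ, (ns.flatMap h).length = ns.sum := fun ns => by
    induction ns with
    | nil => rfl
    | cons n ns ih => rw [List.flatMap_cons, List.length_append, ih, (hh n).1, List.sum_cons]
  have hdh : ∀ ns : List ℕ, ∀ d ∈ ns.flatMap h, d < C := fun ns d hd => by
    obtain ⟨n, -, hn⟩ := List.mem_flatMap.1 hd
    exact (hh n).2 d hn
  have hmX : ∀ p : List F, (p.map lX).flatMap h = p.flatMap XW := fun p => by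
    rw [List.flatMap_map]; congr 1; funext f; exact hhX f
  have hmY : ∀ p : List F, (p.map lY).flatMap h = p.flatMap YW := fun p => by
    rw [List.flatMap_map]; congr 1; funext f; exact hhY f
  refine ⟨m0 + 4, mat1 m0 C, mat2 m0 B dig g, by omega, ut1 _ _, ut2 _ _ _ _, fun φ e1 e2 => ⟨_, rfl, ?_⟩⟩
  intro p0 s hp0
  have htrue : ∀ ns, φ (FreeMonoid.ofList (true :: encW ns)) = mat2 m0 B dig g * PhiL m0 B C dig g ns := by
    intro ns
    rw [FreeMonoid.ofList_cons, map_mul, e2, phi_enc φ e1 e2]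
  have hmul : ∀ a b, φ (FreeMonoid.ofList (true :: encW a)) * φ (FreeMonoid.ofList (encW b)) =
      mat2 m0 B dig g * PhiL m0 B C dig g (a ++ b) := by
    intro a b
    rw [← map_mul, ← FreeMonoid.ofList_append, List.cons_append, ← encW_append, htrue]
  have hcl := fun M => mem_closure_iff φ M
  rw [e1, e2] at hcl
  constructor
  · rintro ⟨N1, hN1, N2, hN2, heq, -⟩
    obtain ⟨w1, rfl⟩ := (hcl _).1 hN1
    obtain ⟨w2, rfl⟩ := (hcl _).1 hN2
    obtain ⟨ns, hns⟩ := exists_encW w1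
    obtain ⟨ns', hns'⟩ := exists_encW w2
    have heq2 := congrArg (fun M => M * φ (FreeMonoid.ofList [true])) heq
    dsimp only at heq2
    rw [mul_assoc, mul_assoc, ← map_mul φ (FreeMonoid.ofList w1), ← map_mul φ (FreeMonoid.ofList w2),
      ← FreeMonoid.ofList_append, ← FreeMonoid.ofList_append, hns, hns', hmul, hmul,
      mat_eq_iff hB hC hdig hg] at heq2
    obtain ⟨h1, h2, h3, h4⟩ := heq2
    rw [D0_iff B dig _ _ h1] at h3
    have hlen : ns.length = ns'.length := by simpa using h1
    have h3' := foldD_path (src := src) (tgt := tgt) B lX lY dig dYX hp0 ns ns'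
    rw [Nat.cast_zero, h3] at h3'
    obtain ⟨p, t, t', hp, rfl, rfl⟩ := exists_pathZ S B lX lY dig H1 H2 s ns ns' hlen h3'.symm
    refine ⟨p, t.flatMap h, t'.flatMap h, hp, ?_⟩
    rw [hV, hV] at h4
    have h5 := val_inj hC (by rw [hlenh, hlenh, h2]) (hdh _) (hdh _) h4
    simpa only [List.flatMap_append, hmX, hmY, List.append_assoc] using h5
  · intro p hp hw
    refine ⟨_, (hcl _).2 ⟨encW (p.map lX), rfl⟩, _, (hcl _).2 ⟨encW (p.map lY), rfl⟩, ?_, ?_⟩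
    · dsimp only
      rw [hmul, hmul, mat_eq_iff hB hC hdig hg]
      have h1 : (p0.map lX ++ p.map lX).length = (p0.map lY ++ p.map lY).length := by simp
      have h5 : (p0.map lX ++ p.map lX).flatMap h = (p0.map lY ++ p.map lY).flatMap h := by
        simpa only [List.flatMap_append, hmX, hmY] using hw
      refine ⟨h1, ?_, ?_, ?_⟩
      · rw [← hlenh, ← hlenh, h5]
      · rw [D0_iff B dig _ _ h1]
        have h3' := foldD_path (src := src) (tgt := tgt) B lX lY dig dYX hp0 (p.map lX) (p.map lY)
        have h4' := foldD_path (src := src) (tgt := tgt) B lX lY dig dYX hp.path [] []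
        simp only [List.append_nil, foldD, Nat.cast_zero] at h3' h4'
        rw [h3', h4']
      · rw [hV, hV, h5]
    · dsimp only
      rw [hmul]
      exact mat_ne_zero hC _

end
end S14

namespace S14

/-! ### Doubling the edges so that all codes have distinct lengths -/

section
variable {E : Type}

/-- Repeat each letter `U` times. -/
def expand {A : Type} (U : ℕ) (l : List A) : List A := l.flatMap (List.replicate U)

theorem expand_length {A : Type} (U : ℕ) (l : List A) : (expand U l).length = U * l.length := by
  simp [expand, List.length_flatMap, mul_comm]

theorem expand_append {A : Type} (U : ℕ) (l l' : List A) : expand U (l ++ l') = expand U l ++ expand U l' := by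
  simp [expand]

theorem expand_prefix_cases {A : Type} {U : ℕ} (hU : 0 < U) (l l' t t' : List A)
    (h : expand U l ++ t = expand U l' ++ t') : l <+: l' ∨ l' <+: l := by
  induction l generalizing l' with
  | nil => exact .inl ⟨_, rfl⟩
  | cons a l ih =>
    cases l' with
    | nil => exact .inr ⟨_, rfl⟩
    | cons b l' =>
      simp only [expand, List.flatMap_cons, List.append_assoc] at h
      obtain ⟨h1, h2⟩ := List.append_inj h (by simp)
      have hab : a = b := by
        have : a ∈ List.replicate U b := by rw [← h1]; simp; omega
        exact List.eq_of_mem_replicate this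
      subst hab
      simpa [List.cons_prefix_cons] using ih l' h2

def src2 (src : E → ℕ) (ix : E → ℕ) : E × Bool → ℕ
  | (e, false) => 2 * src e
  | (e, true) => 2 * ix e + 1
def tgt2 (tgt : E → ℕ) (ix : E → ℕ) : E × Bool → ℕ
  | (e, false) => 2 * ix e + 1
  | (e, true) => 2 * tgt e
def half (cut : E → ℕ) (w : E → List ℕ) : E × Bool → List ℕ
  | (e, false) => (w e).take (cut e)
  | (e, true) => (w e).drop (cut e)

def dbl (p : List E) : List (E × Bool) := p.flatMap fun e => [(e, false), (e, true)]

theorem dbl_append (p q : List E) : dbl (p ++ q) = dbl p ++ dbl q := by simp [dbl]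

theorem dbl_half (cut : E → ℕ) (U : ℕ) (w : E → List ℕ) (p : List E) :
    (dbl p).flatMap (half cut fun e => expand U (w e)) = expand U (p.flatMap w) := by
  induction p with
  | nil => rfl
  | cons e p ih =>
    rw [List.flatMap_cons, expand_append, ← ih]
    simp [dbl, half]
    rw [← List.append_assoc, List.take_append_drop]

variable {src tgt ix : E → ℕ}

theorem path_dbl {s t : ℕ} {p : List E} (h : Path src tgt s p t) :
    Path (src2 src ix) (tgt2 tgt ix) (2 * s) (dbl p) (2 * t) := by
  induction p generalizing s with
  | nil => obtain rfl : s = t := h; rfl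
  | cons e p ih =>
    obtain ⟨rfl, h⟩ := h
    exact ⟨rfl, rfl, ih h⟩

theorem pathZ_dbl {s : ℕ} {p : List E} (h : PathZ src tgt s p) :
    PathZ (src2 src ix) (tgt2 tgt ix) (2 * s) (dbl p) := by
  induction p generalizing s with
  | nil => obtain rfl : s = 0 := h; rfl
  | cons e p ih =>
    obtain ⟨h0, rfl, h⟩ := h
    refine ⟨by omega, rfl, ?_, rfl, ih h⟩
    simp [tgt2]

theorem pathZ_undbl (hix : Function.Injective ix) : ∀ (P : List (E × Bool)) (s : ℕ),
    PathZ (src2 src ix) (tgt2 tgt ix) (2 * s) P → ∃ p, P = dbl p ∧ PathZ src tgt s p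
  | [], s, h => ⟨[], rfl, by have : 2 * s = 0 := h; show s = 0; omega⟩
  | [(e, true)], s, h => by
    have := h.2.1
    simp only [src2] at this
    omega
  | [(e, false)], s, h => by
    have : tgt2 tgt ix (e, false) = 0 := h.2.2
    simp [tgt2] at this
  | (e, true) :: _ :: P, s, h => by
    have := h.2.1
    simp only [src2] at this
    omega
  | (e, false) :: (e', false) :: P, s, h => by
    have := h.2.2.2.1
    simp only [src2, tgt2] at this
    omega
  | (e, false) :: (e', true) :: P, s, h => by
    obtain ⟨h0, h1, -, h2, h3⟩ := h
    simp only [src2, tgt2] at h1 h2 h3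
    obtain rfl : e' = e := hix (by omega)
    obtain ⟨p, rfl, hp⟩ := pathZ_undbl hix P (tgt e') h3
    exact ⟨e' :: p, rfl, by omega, by omega, hp⟩

theorem len_mod {U q c : ℕ} (hq : 0 < q) (hc : 0 < c) (hcU : c < U) : (U * q - c) % U = U - c := by
  obtain ⟨q, rfl⟩ := Nat.exists_eq_succ_of_ne_zero hq.ne'
  have : U * (q + 1) - c = U * q + (U - c) := by rw [Nat.mul_add]; omega
  rw [Nat.succ_eq_add_one, this, Nat.mul_add_mod, Nat.mod_eq_of_lt (by omega)]

theorem encW_flatMap (l : E × Bool → ℕ) (p : List E) :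
    encW ((dbl p).map l) = p.flatMap fun e => encW [l (e, false), l (e, true)] := by
  induction p with
  | nil => rfl
  | cons e p ih =>
    rw [List.flatMap_cons, ← ih, ← encW_append]
    simp [dbl]

theorem reduction2 [Finite E] (src tgt : E → ℕ) (xw yw : E → List ℕ) (C : ℕ) (hC : 2 ≤ C)
    (hX : ∀ f, ∀ d ∈ xw f, d < C) (hY : ∀ f, ∀ d ∈ yw f, d < C)
    (hx : ∀ f, xw f ≠ []) (hy : ∀ f, yw f ≠ []) :
    ∃ (k : ℕ) (M1 M2 : Matrix (Fin k) (Fin k) ℕ),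
      0 < k ∧ MatrixUpperTriangular M1 ∧ MatrixUpperTriangular M2 ∧
      ∃ cX cY : E → List Bool, 
      ∀ φ : FreeMonoid Bool →* Matrix (Fin k) (Fin k) ℕ,
        φ (FreeMonoid.of false) = M1 →
        φ (FreeMonoid.of true) = M2 →
        ∃ cond : List Bool × List Bool → Prop, (cond = (fun uv : List Bool × List Bool =>
          ∃ N1 ∈ Submonoid.closure ({M1, M2} : Set (Matrix (Fin k) (Fin k) ℕ)),
            ∃ N2 ∈ Submonoid.closure ({M1, M2} : Set (Matrix (Fin k) (Fin k) ℕ)),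
            φ (FreeMonoid.ofList uv.1) * N1 = φ (FreeMonoid.ofList uv.2) * N2 ∧
            φ (FreeMonoid.ofList uv.1) * N1 ≠ 0)) ∧
        ∀ (p0 : List E) (s : ℕ), Path src tgt 0 p0 s →
          (cond (true :: p0.flatMap cX, true :: p0.flatMap cY) →
            ∃ p, PathZ src tgt s p ∧ ((p0 ++ p).flatMap xw <+: (p0 ++ p).flatMap yw ∨
              (p0 ++ p).flatMap yw <+: (p0 ++ p).flatMap xw)) ∧
          (∀ p, PathZ src tgt s p → (p0 ++ p).flatMap xw = (p0 ++ p).flatMap yw →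
            cond (true :: p0.flatMap cX, true :: p0.flatMap cY)) := by
  obtain ⟨m, ⟨eE⟩⟩ := Finite.exists_equiv_fin E
  set ix : E → ℕ := fun f => (eE f).val with hixdef
  have hix : Function.Injective ix := fun a b h => eE.injective (Fin.ext h)
  have hm : ∀ f, ix f < m := fun f => (eE f).isLt
  set U := 4 * m + 2 with hU
  set XW := half (fun e => ix e + 1) fun e => expand U (xw e) with hXW
  set YW := half (fun e => m + ix e + 1) fun e => expand U (yw e) with hYW
  have hge : ∀ (w : List ℕ), w ≠ [] → U ≤ U * w.length := fun w hw =>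
    Nat.le_mul_of_pos_right _ (List.length_pos_iff.2 hw)
  have lXf : ∀ e, (XW (e, false)).length = ix e + 1 := fun e => by
    have := hge _ (hx e); have := hm e
    simp only [hXW, half, List.length_take, expand_length]; omega
  have lYf : ∀ e, (YW (e, false)).length = m + ix e + 1 := fun e => by
    have := hge _ (hy e); have := hm e
    simp only [hYW, half, List.length_take, expand_length]; omega
  have lXt : ∀ e, (XW (e, true)).length % U = U - (ix e + 1) := fun e => by
    have := hm e
    simp only [hXW, half, List.length_drop, expand_length]
    exact len_mod (List.length_pos_iff.2 (hx e)) (by omega) (by omega)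
  have lYt : ∀ e, (YW (e, true)).length % U = U - (m + ix e + 1) := fun e => by
    have := hm e
    simp only [hYW, half, List.length_drop, expand_length]
    exact len_mod (List.length_pos_iff.2 (hy e)) (by omega) (by omega)
  have lXf' : ∀ e, (XW (e, false)).length % U = ix e + 1 := fun e => by
    have := hm e
    rw [lXf, Nat.mod_eq_of_lt (by omega)]
  have lYf' : ∀ e, (YW (e, false)).length % U = m + ix e + 1 := fun e => by
    have := hm e
    rw [lYf, Nat.mod_eq_of_lt (by omega)]
  have hinj : Function.Injective (Sum.elim (fun f => (XW f).length) (fun f => (YW f).length)) := by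
    intro a b hab
    have hab := congrArg (· % U) hab
    rcases a with ⟨e, b1⟩ | ⟨e, b1⟩ <;> rcases b with ⟨e', b2⟩ | ⟨e', b2⟩ <;> cases b1 <;> cases b2 <;>
      simp only [Sum.elim_inl, Sum.elim_inr, lXt, lYt, lXf', lYf'] at hab <;>
      have h1 := hm e <;> have h2 := hm e' <;>
      first
        | (exfalso; omega)
        | (obtain rfl : e = e' := hix (by omega); rfl)
  have hmem : ∀ (cut : E → ℕ) (w : E → List ℕ), (∀ f, ∀ d ∈ w f, d < C) →
      ∀ f, ∀ d ∈ half cut (fun e => expand U (w e)) f, d < C := by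
    intro cut w hw f d hd
    have : d ∈ expand U (w f.1) := by
      rcases f with ⟨e, _ | _⟩
      · exact List.mem_of_mem_take hd
      · exact List.mem_of_mem_drop hd
    obtain ⟨x, h1, h2⟩ := List.mem_flatMap.1 this
    rw [List.eq_of_mem_replicate h2]
    exact hw _ _ h1
  obtain ⟨k, M1, M2, hk, hM1, hM2, H⟩ := reduction (src2 src ix) (tgt2 tgt ix) XW YW C hC
    (hmem _ _ hX) (hmem _ _ hY) hinj
  refine ⟨k, M1, M2, hk, hM1, hM2, fun e => encW [(XW (e, false)).length, (XW (e, true)).length],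
    fun e => encW [(YW (e, false)).length, (YW (e, true)).length], fun φ e1 e2 => ?_⟩
  obtain ⟨cond, hc, H⟩ := H φ e1 e2
  refine ⟨cond, hc, fun p0 s hp0 => ?_⟩
  have H := H (dbl p0) (2 * s) (path_dbl hp0)
  rw [encW_flatMap, encW_flatMap] at H
  refine ⟨fun h => ?_, fun p hp hw => ?_⟩
  · obtain ⟨P, t, t', hP, h⟩ := H.1 h
    obtain ⟨p, rfl, hp⟩ := pathZ_undbl hix P s hP
    rw [← dbl_append, hXW, hYW, dbl_half, dbl_half] at h
    exact ⟨p, hp, expand_prefix_cases (by omega) _ _ _ _ h⟩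
  · refine H.2 (dbl p) (pathZ_dbl hp) ?_
    rw [← dbl_append, hXW, hYW, dbl_half, dbl_half, hw]

end
end S14

namespace S14
open Turing Turing.ToPartrec Turing.PartrecToTM2

/-! ### The final graph -/

inductive Edge (A σ : Type)
  | ini
  | ld
  | go
  | st (s : σ) (a : A)
  | fin (s : σ)

instance finiteEdge {A σ : Type} [Finite A] [Finite σ] : Finite (Edge A σ) :=
  Finite.of_surjective (fun x : Option (Option (Option (σ × Option A))) => match x with
    | none => Edge.ini
    | some none => Edge.ld
    | some (some none) => Edge.go
    | some (some (some (s, some a))) => Edge.st s a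
    | some (some (some (s, none))) => Edge.fin s) (by
    rintro (_ | _ | _ | ⟨s, a⟩ | s)
    · exact ⟨none, rfl⟩
    · exact ⟨some none, rfl⟩
    · exact ⟨some (some none), rfl⟩
    · exact ⟨some (some (some (s, some a))), rfl⟩
    · exact ⟨some (some (some (s, none))), rfl⟩)

section
variable {A σ T : Type} (M : DFA A σ) (num : σ → ℕ)

def Edge.src : Edge A σ → ℕ
  | ini => 0
  | ld => 1
  | go => 1
  | st s _ => num s + 3
  | fin s => num s + 3

open Classical in
noncomputable def Edge.tgt : Edge A σ → ℕ
  | ini => 1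
  | ld => 1
  | go => num M.start + 3
  | st s a => num (M.step s a) + 3
  | fin s => if s ∈ M.accept then 0 else 2

def Edge.xw (b : T) (out : A → List T) (tl : List T) : Edge A σ → List (Option T)
  | ini => [some b, some b]
  | ld => [some b, some b]
  | go => tl.map some
  | st _ a => (out a).map some
  | fin _ => [none]

def Edge.yw (b : T) (inp : A → List T) (F : List T) : Edge A σ → List (Option T)
  | ini => [some b]
  | ld => [some b]
  | go => [some b]
  | st _ a => (inp a).map some
  | fin _ => F.map some ++ [none]

def edges : σ → List A → List (Edge A σ)
  | s, [] => [.fin s]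
  | s, a :: w => .st s a :: edges (M.step s a) w

variable {M num}

theorem pathZ_edges (s : σ) (w : List A) (h : M.evalFrom s w ∈ M.accept) :
    PathZ (Edge.src num) (Edge.tgt M num) (num s + 3) (edges M s w) := by
  induction w generalizing s with
  | nil => exact ⟨by omega, rfl, if_pos h⟩
  | cons a w ih => exact ⟨by omega, rfl, ih _ h⟩

theorem edges_of_pathZ (hnum : Function.Injective num) (s : σ) (p : List (Edge A σ))
    (h : PathZ (Edge.src num) (Edge.tgt M num) (num s + 3) p) :
    ∃ w, M.evalFrom s w ∈ M.accept ∧ p = edges M s w := by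
  induction p generalizing s with
  | nil => have : num s + 3 = 0 := h; omega
  | cons e p ih =>
    obtain ⟨-, h1, h2⟩ := h
    rcases e with _ | _ | _ | ⟨s', a⟩ | s'
    · simp [Edge.src] at h1
    · simp [Edge.src] at h1
    · simp [Edge.src] at h1
    · obtain rfl : s' = s := hnum (by simpa [Edge.src] using h1)
      obtain ⟨w, hw, rfl⟩ := ih _ h2
      exact ⟨a :: w, hw, rfl⟩
    · obtain rfl : s' = s := hnum (by simpa [Edge.src] using h1)
      by_cases hs : s' ∈ M.accept
      · simp only [Edge.tgt, if_pos hs] at h2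
        cases p with
        | nil => exact ⟨[], hs, rfl⟩
        | cons e p => exact absurd rfl h2.1
      · simp only [Edge.tgt, if_neg hs] at h2
        cases p with
        | nil => cases h2
        | cons e p =>
          have := h2.2.1
          rcases e with _ | _ | _ | ⟨s', a⟩ | s' <;> simp [Edge.src] at this

theorem edges_xw (b : T) (out : A → List T) (tl : List T) (s : σ) (w : List A) :
    (edges M s w).flatMap (Edge.xw b out tl) = (w.flatMap out).map some ++ [none] := by
  induction w generalizing s with
  | nil => rfl
  | cons a w ih => simp [edges, ih, Edge.xw]

theorem edges_yw (b : T) (inp : A → List T) (F : List T) (s : σ) (w : List A) :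
    (edges M s w).flatMap (Edge.yw b inp F) = (w.flatMap inp ++ F).map some ++ [none] := by
  induction w generalizing s with
  | nil => simp [edges, Edge.yw]
  | cons a w ih => simp [edges, ih, Edge.yw]

def pre (n : ℕ) : List (Edge A σ) := .ini :: ((List.range n).map (fun _ => .ld) ++ [.go])

theorem path_pre (n : ℕ) : Path (Edge.src num) (Edge.tgt M num) 0 (pre n) (num M.start + 3) := by
  refine ⟨rfl, ?_⟩
  rw [List.map_const']
  generalize (List.range n).length = m
  induction m with
  | zero => exact ⟨rfl, rfl⟩
  | succ m ih => exact ⟨rfl, ih⟩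

theorem pre_xw (b : T) (out : A → List T) (tl : List T) (n : ℕ) :
    (pre n : List (Edge A σ)).flatMap (Edge.xw b out tl) =
      (List.replicate (n + 2) b ++ (List.replicate n b ++ tl)).map some := by
  have h : ∀ m, (List.replicate m (Edge.ld : Edge A σ)).flatMap (Edge.xw b out tl)
      = List.replicate (2 * m) (some b) := by
    intro m
    induction m with
    | zero => rfl
    | succ m ih =>
      rw [List.replicate_succ, List.flatMap_cons, ih, Nat.mul_succ, Nat.add_comm, List.replicate_add]
      rfl
  rw [pre, List.map_const', List.length_range, List.flatMap_cons, List.flatMap_append, h,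
    ← List.append_assoc (List.replicate (n+2) b), ← List.replicate_add,
    show n + 2 + n = 2 + 2 * n by omega, List.replicate_add]
  simp [Edge.xw, List.replicate_succ]

theorem pre_yw (b : T) (inp : A → List T) (F : List T) (n : ℕ) :
    (pre n : List (Edge A σ)).flatMap (Edge.yw b inp F) = (List.replicate (n + 2) b).map some := by
  have h : ∀ m, (List.replicate m (Edge.ld : Edge A σ)).flatMap (Edge.yw b inp F)
      = List.replicate m (some b) := by
    intro m
    induction m with
    | zero => rfl
    | succ m ih =>
      rw [List.replicate_succ, List.flatMap_cons, ih]
      rfl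
  rw [pre, List.map_const', List.length_range, List.flatMap_cons, List.flatMap_append, h,
    show n + 2 = 1 + n + 1 by omega, List.replicate_add, List.replicate_add]
  simp [Edge.yw]

theorem eq_of_prefix_mark (a b : List T) (h : a.map some ++ [none] <+: b.map some ++ [none]) : a = b := by
  induction a generalizing b with
  | nil =>
    cases b with
    | nil => rfl
    | cons y b => simp at h
  | cons x a ih =>
    cases b with
    | nil => simp at h
    | cons y b =>
      simp only [List.map_cons, List.cons_append, List.cons_prefix_cons, Option.some.injEq] at h
      rw [h.1, ih b h.2]

end

theorem pre_computable {A σ : Type} (c : Edge A σ → List Bool) :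
    Computable (fun n : ℕ => true :: (pre n : List (Edge A σ)).flatMap c) := by
  have h : (fun n : ℕ => true :: (pre n : List (Edge A σ)).flatMap c) =
      fun n => (true :: c .ini) ++ ((List.range n).flatMap (fun _ => c .ld) ++ c .go) := by
    funext n
    rw [pre, List.flatMap_cons, List.flatMap_append, List.flatMap_map]
    simp
  rw [h]
  refine Primrec.to_comp ?_
  refine Primrec.list_append.comp (Primrec.const _) (Primrec.list_append.comp ?_ (Primrec.const _))
  exact Primrec.list_flatMap Primrec.list_range (Primrec₂.const _)

theorem main :
    ∃ (k : ℕ) (M1 M2 : Matrix (Fin k) (Fin k) ℕ),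
      0 < k ∧ MatrixUpperTriangular M1 ∧ MatrixUpperTriangular M2 ∧
      ∀ φ : FreeMonoid Bool →* Matrix (Fin k) (Fin k) ℕ,
        φ (FreeMonoid.of false) = M1 →
        φ (FreeMonoid.of true) = M2 →
        ¬ ComputablePred (fun uv : List Bool × List Bool =>
          ∃ N1 ∈ Submonoid.closure ({M1, M2} : Set (Matrix (Fin k) (Fin k) ℕ)),
            ∃ N2 ∈ Submonoid.closure ({M1, M2} : Set (Matrix (Fin k) (Fin k) ℕ)),
            φ (FreeMonoid.ofList uv.1) * N1 = φ (FreeMonoid.ofList uv.2) * N2 ∧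
            φ (FreeMonoid.ofList uv.1) * N1 ≠ 0) := by
  obtain ⟨c, hc⟩ := exists_undecidable
  obtain ⟨Q, hQ, hQd, L, tl, F, hL, htl, hH⟩ := exists_queue c
  obtain ⟨σ, hσ, M, rfl⟩ := hL
  obtain ⟨nσ, ⟨eσ⟩⟩ := Finite.exists_equiv_fin σ
  set num : σ → ℕ := fun f => (eσ f).val
  have hnum : Function.Injective num := fun a b h => eσ.injective (Fin.ext h)
  obtain ⟨C, ⟨eC⟩⟩ := Finite.exists_equiv_fin (Option (Sym Q))
  set cd : Option (Sym Q) → ℕ := fun x => (eC x).val with hcd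
  have hcdinj : Function.Injective cd := fun a b h => eC.injective (Fin.ext h)
  obtain ⟨dc, hdc⟩ := hcdinj.hasLeftInverse
  have hmapinv : ∀ l : List (Option (Sym Q)), (l.map cd).map dc = l := fun l => by
    rw [List.map_map, hdc.id, List.map_id]
  let b : Sym Q := .sy .bit0
  let x : Edge (Act Q) σ → List (Option (Sym Q)) := Edge.xw b Act.out tl
  let y : Edge (Act Q) σ → List (Option (Sym Q)) := Edge.yw b Act.inp F
  have hlt : ∀ (z : Edge (Act Q) σ → List (Option (Sym Q))) f, ∀ d ∈ (z f).map cd, d < C + 2 := by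
    intro z f d hd
    obtain ⟨o, -, rfl⟩ := List.mem_map.1 hd
    have := (eC o).isLt
    simp only [hcd]; omega
  obtain ⟨k, M1, M2, hk, hM1, hM2, cX, cY, H⟩ := reduction2 (Edge.src num) (Edge.tgt M num)
    (fun e => (x e).map cd) (fun e => (y e).map cd) (C + 2) (by omega) (hlt x) (hlt y)
    (by
      rintro (_ | _ | _ | ⟨s, a⟩ | s) <;> simp [x, Edge.xw, htl]
      cases a <;> simp [Act.out])
    (by
      rintro (_ | _ | _ | ⟨s, a⟩ | s) <;> simp [y, Edge.yw]
      cases a <;> simp [Act.inp])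
  refine ⟨k, M1, M2, hk, hM1, hM2, fun φ e1 e2 hcomp => hc ?_⟩
  obtain ⟨cond, hcond, H⟩ := H φ e1 e2
  rw [← hcond] at hcomp
  have hfx : ∀ n w, ((pre n ++ edges M M.start w).flatMap fun e => (x e).map cd) =
      ((List.replicate (n + 2) b ++ (List.replicate n b ++ tl ++ w.flatMap Act.out)).map some
        ++ [none]).map cd := by
    intro n w
    rw [← List.map_flatMap, List.flatMap_append, pre_xw, edges_xw]
    simp
  have hfy : ∀ n w, ((pre n ++ edges M M.start w).flatMap fun e => (y e).map cd) =
      ((List.replicate (n + 2) b ++ (w.flatMap Act.inp ++ F)).map some ++ [none]).map cd := by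
    intro n w
    rw [← List.map_flatMap, List.flatMap_append, pre_yw, edges_yw]
    simp
  have hiff : ∀ n, Halts c n ↔ cond (true :: (pre n).flatMap cX, true :: (pre n).flatMap cY) := by
    intro n
    have Hn := H (pre n) _ (path_pre n)
    rw [hH n]
    constructor
    · rintro ⟨w, hw, h⟩
      refine Hn.2 _ (pathZ_edges M.start w hw) ?_
      rw [hfx, hfy, h]
    · intro h
      obtain ⟨p, hp, h⟩ := Hn.1 h
      obtain ⟨w, hw, rfl⟩ := edges_of_pathZ hnum _ _ hp
      refine ⟨w, hw, ?_⟩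
      rw [hfx, hfy] at h
      apply List.append_cancel_left (as := List.replicate (n + 2) b)
      rcases h with h | h
      · have h := h.map dc
        rw [hmapinv, hmapinv] at h
        exact eq_of_prefix_mark _ _ h
      · have h := h.map dc
        rw [hmapinv, hmapinv] at h
        exact (eq_of_prefix_mark _ _ h).symm
  refine ComputablePred.computable_of_manyOneReducible
    ⟨fun n => (true :: (pre n).flatMap cX, true :: (pre n).flatMap cY), ?_, hiff⟩ hcomp
  exact (pre_computable cX).pair (pre_computable cY)

end S14

/-- undecidability of the existence of a nonannihilating solution of
`a x = b y` over the monoid generated by two upper triangular matrices with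
nonnegative integer entries; `φ` is the monoid homomorphism from the free monoid on
two letters sending the first letter to `M1` and the second to `M2`. -/
theorem statement14 :
    ∃ (k : ℕ) (M1 M2 : Matrix (Fin k) (Fin k) ℕ),
      0 < k ∧ MatrixUpperTriangular M1 ∧ MatrixUpperTriangular M2 ∧
      ∀ φ : FreeMonoid Bool →* Matrix (Fin k) (Fin k) ℕ,
        φ (FreeMonoid.of false) = M1 →
        φ (FreeMonoid.of true) = M2 →
        ¬ ComputablePred (fun uv : List Bool × List Bool =>
          ∃ N1 ∈ Submonoid.closure ({M1, M2} : Set (Matrix (Fin k) (Fin k) ℕ)),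
            ∃ N2 ∈ Submonoid.closure ({M1, M2} : Set (Matrix (Fin k) (Fin k) ℕ)),
            φ (FreeMonoid.ofList uv.1) * N1 = φ (FreeMonoid.ofList uv.2) * N2 ∧
            φ (FreeMonoid.ofList uv.1) * N1 ≠ 0) := S14.main
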